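/- arXiv:1812.11043 — 11 statements merged into one kernel-verified Lean document; each statement's English description precedes it below -/
import Mathlib

section
/- Let A and Ã be integers with A ≡ Ã (mod 2). Then the ring homomorphism from ℤ[x₁,x₂] to ℤ[x̃₁,x̃₂]/⟨x̃₂², x̃₁² + Ã·x̃₁·x̃₂⟩ determined by x₁ ↦ x̃₁ + ((Ã−A)/2)·x̃₂ and x₂ ↦ x̃₂ descends to a ring isomorphism ℤ[x₁,x₂]/⟨x₂², x₁² + A·x₁·x₂⟩ ≅ ℤ[x̃₁,x̃₂]/⟨x̃₂², x̃₁² + Ã·x̃₁·x̃₂⟩. -/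
open MvPolynomial

/-- The integral cohomology ring presentation ideal of the Hirzebruch surface `ℋ_{-A}`:
`⟨x₂², x₁² + A·x₁·x₂⟩ ⊆ ℤ[x₁,x₂]`, with `x₁ = X 0` and `x₂ = X 1`. -/
noncomputable def hirzebruchIdeal (A : ℤ) : Ideal (MvPolynomial (Fin 2) ℤ) :=
  Ideal.span {(X 1 : MvPolynomial (Fin 2) ℤ) ^ 2, X 0 ^ 2 + C A * X 0 * X 1}

/-- The substitution `x₁ ↦ x₁ + k x₂`, `x₂ ↦ x₂`. -/
noncomputable def hirzSubst (k : ℤ) : MvPolynomial (Fin 2) ℤ →+* MvPolynomial (Fin 2) ℤ :=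
  (bind₁ ![X 0 + C k * X 1, X 1]).toRingHom

lemma hirzSubst_X0 (k : ℤ) : hirzSubst k (X 0) = X 0 + C k * X 1 := by
  simp [hirzSubst]

lemma hirzSubst_X1 (k : ℤ) : hirzSubst k (X 1) = X 1 := by
  simp [hirzSubst]

lemma hirzSubst_C (k a : ℤ) : hirzSubst k (C a) = C a := by
  simp [hirzSubst]

lemma hirzSubst_le (A B k : ℤ) (h : B = A + 2 * k) :
    hirzebruchIdeal A ≤ (hirzebruchIdeal B).comap (hirzSubst k) := by
  rw [hirzebruchIdeal, Ideal.span_le]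
  rintro p (rfl | rfl)
  · simp only [SetLike.mem_coe, Ideal.mem_comap, map_pow, hirzSubst_X1]
    exact Ideal.subset_span (by simp)
  · simp only [SetLike.mem_coe, Ideal.mem_comap, map_pow, map_add, map_mul, hirzSubst_X1,
      hirzSubst_X0, hirzSubst_C]
    refine Ideal.mem_span_pair.2 ⟨C k ^ 2 + C A * C k, 1, ?_⟩
    subst h
    simp only [map_add, map_mul, map_ofNat]
    ring

lemma hirzSubst_comp (j k : ℤ) (h : j + k = 0) :
    (hirzSubst j).comp (hirzSubst k) = RingHom.id _ := by
  obtain rfl : j = -k := by omega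
  apply MvPolynomial.ringHom_ext
  · intro a
    simp only [RingHom.comp_apply, hirzSubst_C, RingHom.id_apply]
  · intro i
    fin_cases i
    · simp [hirzSubst_X0, hirzSubst_X1, hirzSubst_C]
    · simp [hirzSubst_X1]

/-- If `A ≡ A' (mod 2)`, the ring homomorphism `ℤ[x₁,x₂] → ℤ[x̃₁,x̃₂]/⟨x̃₂², x̃₁² + A'·x̃₁·x̃₂⟩`
determined by `x₁ ↦ x̃₁ + ((A'−A)/2)·x̃₂`, `x₂ ↦ x̃₂` descends to a ring isomorphism
`ℤ[x₁,x₂]/⟨x₂², x₁² + A·x₁·x₂⟩ ≅ ℤ[x̃₁,x̃₂]/⟨x̃₂², x̃₁² + A'·x̃₁·x̃₂⟩`. -/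
theorem stmt_0 (A A' : ℤ) (h : A % 2 = A' % 2) :
    ∃ e : (MvPolynomial (Fin 2) ℤ ⧸ hirzebruchIdeal A) ≃+*
        (MvPolynomial (Fin 2) ℤ ⧸ hirzebruchIdeal A'),
      (e : (MvPolynomial (Fin 2) ℤ ⧸ hirzebruchIdeal A) →+*
          (MvPolynomial (Fin 2) ℤ ⧸ hirzebruchIdeal A')).comp
          (Ideal.Quotient.mk (hirzebruchIdeal A)) =
        (Ideal.Quotient.mk (hirzebruchIdeal A')).comp
          (bind₁ ![X 0 + C ((A' - A) / 2) * X 1, X 1]).toRingHom := by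
  obtain ⟨k, hk⟩ : ∃ k, k = (A' - A) / 2 := ⟨_, rfl⟩
  have h1 : A' = A + 2 * k := by omega
  have h2 : A = A' + 2 * (-k) := by omega
  rw [← hk]
  have c1 := hirzSubst_comp (-k) k (by omega)
  have c2 := hirzSubst_comp k (-k) (by omega)
  refine ⟨RingEquiv.ofRingHom
    (Ideal.quotientMap _ (hirzSubst k) (hirzSubst_le A A' k h1))
    (Ideal.quotientMap _ (hirzSubst (-k)) (hirzSubst_le A' A (-k) h2)) ?_ ?_, ?_⟩
  · apply Ideal.Quotient.ringHom_ext
    refine RingHom.ext fun p => ?_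
    have := RingHom.congr_fun c2 p
    simp only [RingHom.comp_apply, RingHom.id_apply] at this
    simp only [RingHom.comp_apply, Ideal.quotientMap_mk, RingHom.id_apply, this]
  · apply Ideal.Quotient.ringHom_ext
    refine RingHom.ext fun p => ?_
    have := RingHom.congr_fun c1 p
    simp only [RingHom.comp_apply, RingHom.id_apply] at this
    simp only [RingHom.comp_apply, Ideal.quotientMap_mk, RingHom.id_apply, this]
  · exact RingHom.ext fun p => rfl
end

section
/- Let A and Ã be integers with A ≡ Ã (mod 2), and let F : ℤ[x₁,x₂]/⟨x₂², x₁² + A·x₁·x₂⟩ → ℤ[x̃₁,x̃₂]/⟨x̃₂², x̃₁² + Ã·x̃₁·x̃₂⟩ be the ring isomorphism determined by x₁ ↦ x̃₁ + ((Ã−A)/2)·x̃₂ and x₂ ↦ x̃₂. Then for all integers λ₁, λ₂, λ̃₁, λ̃₂: F(λ₁·x₁ + λ₂·x₂) = λ₁·x̃₁ + (λ₂ + ((Ã−A)/2)·λ₁)·x̃₂, and F(λ₁·x₁ + λ₂·x₂) = λ̃₁·x̃₁ + λ̃₂·x̃₂ holds in the quotient ring if and only if λ₁ = λ̃₁ and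 2λ₂ − A·λ₁ = 2λ̃₂ − Ã·λ̃₁. -/
open MvPolynomial

/-- Linear forms are independent modulo the ideal, detected by maps to the dual numbers. -/
lemma hirz_lin_indep (A c d c' d' : ℤ)
    (h : Ideal.Quotient.mk (hirzebruchIdeal A) (C c * X 0 + C d * X 1) =
      Ideal.Quotient.mk (hirzebruchIdeal A) (C c' * X 0 + C d' * X 1)) : c = c' ∧ d = d' := by
  have key : ∀ a b : ℤ, c * a + d * b = c' * a + d' * b := by
    intro a b
    let f : MvPolynomial (Fin 2) ℤ →+* DualNumber ℤ :=
      eval₂Hom (Int.castRingHom _) ![TrivSqZeroExt.inr a, TrivSqZeroExt.inr b]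
    have f0 : f (X 0) = TrivSqZeroExt.inr a := by
      simp only [f, coe_eval₂Hom, eval₂_X]; rfl
    have f1 : f (X 1) = TrivSqZeroExt.inr b := by
      simp only [f, coe_eval₂Hom, eval₂_X]; rfl
    have fC : ∀ n : ℤ, f (C n) = (n : DualNumber ℤ) := by
      intro n
      simp only [f, coe_eval₂Hom, eval₂_C]; rfl
    have hle : hirzebruchIdeal A ≤ RingHom.ker f := by
      unfold hirzebruchIdeal
      rw [Ideal.span_le]
      rintro p (rfl | rfl)
      · rw [SetLike.mem_coe, RingHom.mem_ker, pow_two, map_mul, f1, TrivSqZeroExt.inr_mul_inr]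
      · rw [SetLike.mem_coe, RingHom.mem_ker, pow_two, map_add, map_mul, mul_assoc, map_mul,
          map_mul, f0, f1, TrivSqZeroExt.inr_mul_inr, TrivSqZeroExt.inr_mul_inr, mul_zero,
          add_zero]
    have h2 := hle (Ideal.Quotient.eq.mp h)
    rw [RingHom.mem_ker, map_sub, sub_eq_zero] at h2
    have h3 := congrArg TrivSqZeroExt.snd h2
    simp only [map_add, map_mul, f0, f1, fC] at h3
    simpa using h3
  have h1 := key 1 0
  have h2 := key 0 1
  constructor <;> linarith

/-- Let `A ≡ A' (mod 2)` and `F` the ring isomorphism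
`ℤ[x₁,x₂]/⟨x₂², x₁² + A·x₁·x₂⟩ ≅ ℤ[x̃₁,x̃₂]/⟨x̃₂², x̃₁² + A'·x̃₁·x̃₂⟩` determined by
`x₁ ↦ x̃₁ + ((A'−A)/2)·x̃₂`, `x₂ ↦ x̃₂`.  Then
`F(λ₁x₁ + λ₂x₂) = λ₁x̃₁ + (λ₂ + ((A'−A)/2)λ₁)x̃₂`, and
`F(λ₁x₁ + λ₂x₂) = λ̃₁x̃₁ + λ̃₂x̃₂` iff `λ₁ = λ̃₁` and `2λ₂ − Aλ₁ = 2λ̃₂ − A'λ̃₁`. -/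
theorem stmt_1 (A A' : ℤ) (h : A % 2 = A' % 2)
    (F : (MvPolynomial (Fin 2) ℤ ⧸ hirzebruchIdeal A) ≃+*
        (MvPolynomial (Fin 2) ℤ ⧸ hirzebruchIdeal A'))
    (hF1 : F (Ideal.Quotient.mk (hirzebruchIdeal A) (X 0)) =
      Ideal.Quotient.mk (hirzebruchIdeal A') (X 0 + C ((A' - A) / 2) * X 1))
    (hF2 : F (Ideal.Quotient.mk (hirzebruchIdeal A) (X 1)) =
      Ideal.Quotient.mk (hirzebruchIdeal A') (X 1))
    (l1 l2 l1' l2' : ℤ) :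
    F (Ideal.Quotient.mk (hirzebruchIdeal A) (C l1 * X 0 + C l2 * X 1)) =
      Ideal.Quotient.mk (hirzebruchIdeal A')
        (C l1 * X 0 + C (l2 + ((A' - A) / 2) * l1) * X 1) ∧
    (F (Ideal.Quotient.mk (hirzebruchIdeal A) (C l1 * X 0 + C l2 * X 1)) =
        Ideal.Quotient.mk (hirzebruchIdeal A') (C l1' * X 0 + C l2' * X 1) ↔
      l1 = l1' ∧ 2 * l2 - A * l1 = 2 * l2' - A' * l1') := by
  have hC : ∀ n : ℤ, F (Ideal.Quotient.mk (hirzebruchIdeal A) (C n)) =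
      Ideal.Quotient.mk (hirzebruchIdeal A') (C n) := by
    intro n
    have e : (C n : MvPolynomial (Fin 2) ℤ) = (n : MvPolynomial (Fin 2) ℤ) := by simp
    rw [e, map_intCast, map_intCast, map_intCast]
  have h1 : F (Ideal.Quotient.mk (hirzebruchIdeal A) (C l1 * X 0 + C l2 * X 1)) =
      Ideal.Quotient.mk (hirzebruchIdeal A')
        (C l1 * X 0 + C (l2 + ((A' - A) / 2) * l1) * X 1) := by
    rw [map_add, map_mul, map_mul, map_add, map_mul, map_mul, hC, hC, hF1, hF2,
      ← map_mul, ← map_mul, ← map_add, C_add, C_mul]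
    congr 1
    ring
  refine ⟨h1, ?_⟩
  rw [h1]
  obtain ⟨k, hk⟩ : ∃ k, A' = A + 2 * k := ⟨(A' - A) / 2, by omega⟩
  have hk2 : (A' - A) / 2 = k := by omega
  rw [hk2]
  constructor
  · intro h2
    obtain ⟨e1, e2⟩ := hirz_lin_indep _ _ _ _ _ h2
    subst e1 e2 hk
    exact ⟨rfl, by ring⟩
  · rintro ⟨e1, e2⟩
    subst e1 hk
    have e3 : l2 + k * l1 = l2' := by linarith
    rw [e3]
end

section
/- Let n ≥ 2 and let P ⊆ (ℝ_{≥0})ⁿ be a smooth lattice polytope (full-dimensional, vertices in ℤⁿ, and at every vertex the primitive integral direction vectors of the n edges meeting there form a ℤ-basis of ℤⁿ) which coincides with (ℝ_{≥0})ⁿ in a neighborhood of the origin (so the origin is a vertex of P whose edge directions are e₁,…,e_n). Fix a non-negative integer c and indices 1 ≤ k < ℓ ≤ n. In the polynomial ring ℂ[u₁,…,u_n] set g_k := u_k + u_ℓ^c and g_j := u_j for j ≠ k, and let V be the ℂ-linear span of the polynomials g^p := ∏_{j=1}^n g_j^{p_j} for p ∈ P ∩ ℤⁿ. Then the set { lex-min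 of the support of f : f ∈ V, f ≠ 0 } equals ℱ_{−e_k + c·e_ℓ}(P ∩ ℤⁿ). -/
open MvPolynomial

/-- `lexLe m m'` : `m` is less than or equal to `m'` in the lexicographic order on exponent
vectors, comparing coordinates from the first to the last. -/
def lexLe {n : ℕ} (m m' : Fin n →₀ ℕ) : Prop :=
  m = m' ∨ ∃ i : Fin n, (∀ j : Fin n, j < i → m j = m' j) ∧ m i < m' i

/-- The sliding operator `ℱ_v` in direction `v`, with distinguished coordinate `k`
(for `v = -e_k + c·e_ℓ`):  each point `q` of `S` is moved to `q + a_q·v`, where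
`a_q` is the minimum of the `k`-th coordinates of the points of `S` lying on the affine
line through `q` in direction `v`. -/
def slide {n : ℕ} (v : Fin n → ℤ) (k : Fin n) (S : Set (Fin n → ℤ)) : Set (Fin n → ℤ) :=
  {y | ∃ q ∈ S, ∃ a : ℤ,
    IsLeast {t : ℤ | ∃ q' ∈ S, (∃ b : ℤ, q' - q = b • v) ∧ t = q' k} a ∧
    y = q + a • v}


namespace Slide

theorem lexLe_of_le {n : ℕ} {m m' : Fin n →₀ ℕ} (h : toLex m ≤ toLex m') : lexLe m m' := by
  rcases h.eq_or_lt with h | h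
  · exact Or.inl (toLex.injective h)
  · obtain ⟨i, h1, h2⟩ := Finsupp.Lex.lt_iff.1 h
    exact Or.inr ⟨i, h1, h2⟩

theorem le_of_lexLe {n : ℕ} {m m' : Fin n →₀ ℕ} (h : lexLe m m') : toLex m ≤ toLex m' := by
  rcases h with h | ⟨i, h1, h2⟩
  · rw [h]
  · exact le_of_lt (Finsupp.Lex.lt_iff.2 ⟨i, h1, h2⟩)

/-- The lex-min of a nonzero combination of polynomials with distinct lex-mins. -/
theorem lexmin_comb {n : ℕ} {ι : Type*} (S : Set ι) (F : ι → MvPolynomial (Fin n) ℂ)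
    (e : ι → Fin n →₀ ℕ) (he : Set.InjOn e S)
    (hc : ∀ q ∈ S, coeff (e q) (F q) ≠ 0)
    (hl : ∀ q ∈ S, ∀ m ∈ (F q).support, toLex (e q) ≤ toLex m)
    (f : MvPolynomial (Fin n) ℂ) (hf : f ∈ Submodule.span ℂ (F '' S)) (hf0 : f ≠ 0) :
    ∃ q ∈ S, coeff (e q) f ≠ 0 ∧ ∀ m ∈ f.support, toLex (e q) ≤ toLex m := by
  classical
  obtain ⟨w, hw, rfl⟩ := (Finsupp.mem_span_image_iff_linearCombination ℂ).1 hf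
  have hwS : ∀ q ∈ w.support, q ∈ S := fun q hq => (Finsupp.mem_supported ℂ w).1 hw hq
  have hne : w.support.Nonempty := by
    rw [Finset.nonempty_iff_ne_empty]
    intro h
    apply hf0
    rw [Finsupp.support_eq_empty.1 h, map_zero]
  obtain ⟨q, hq, hmin⟩ := Finset.exists_min_image w.support (fun q => toLex (e q)) hne
  have hco : ∀ m, coeff m (Finsupp.linearCombination ℂ F w)
      = ∑ i ∈ w.support, w i * coeff m (F i) := by
    intro m
    rw [Finsupp.linearCombination_apply, Finsupp.sum, coeff_sum]
    simp
  refine ⟨q, hwS q hq, ?_, ?_⟩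
  · rw [hco, Finset.sum_eq_single q]
    · exact mul_ne_zero (Finsupp.mem_support_iff.1 hq) (hc q (hwS q hq))
    · intro b hb hbq
      by_contra hne0
      have h1 : e q ∈ (F b).support := mem_support_iff.2 (right_ne_zero_of_mul hne0)
      have h2 := hl b (hwS b hb) _ h1
      have h3 := le_antisymm h2 (hmin b hb)
      exact hbq (he (hwS b hb) (hwS q hq) (toLex.injective h3))
    · intro h; exact absurd hq h
  · intro m hm
    rw [mem_support_iff, hco] at hm
    obtain ⟨b, hb, hb0⟩ := Finset.exists_ne_zero_of_sum_ne_zero hm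
    exact (hmin b hb).trans (hl b (hwS b hb) m (mem_support_iff.2 (right_ne_zero_of_mul hb0)))

/-- The direction vector. -/
def dir {n : ℕ} (c : ℕ) (k l : Fin n) : Fin n → ℤ :=
  fun i => if i = k then -1 else if i = l then (c : ℤ) else 0

/-- The set of `k`-coordinates on the line through `q`. -/
def lineSet {n : ℕ} (v : Fin n → ℤ) (k : Fin n) (S : Set (Fin n → ℤ)) (q : Fin n → ℤ) : Set ℤ :=
  {t : ℤ | ∃ q' ∈ S, (∃ b : ℤ, q' - q = b • v) ∧ t = q' k}

theorem lineSet_add {n : ℕ} (v : Fin n → ℤ) (k : Fin n) (S : Set (Fin n → ℤ)) (q : Fin n → ℤ)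
    (i : ℤ) : lineSet v k S (q + i • v) = lineSet v k S q := by
  ext t
  constructor
  · rintro ⟨q', h, ⟨b, hb⟩, rfl⟩
    refine ⟨q', h, ⟨b + i, ?_⟩, rfl⟩
    rw [add_smul, ← hb]; abel
  · rintro ⟨q', h, ⟨b, hb⟩, rfl⟩
    refine ⟨q', h, ⟨b - i, ?_⟩, rfl⟩
    rw [sub_smul, ← hb]; abel

/-- The exponent with the `k`-coordinate erased. -/
noncomputable def rest {n : ℕ} (k : Fin n) (q : Fin n → ℤ) : Fin n →₀ ℕ :=
  Finsupp.equivFunOnFinite.symm (fun j => if j = k then 0 else (q j).toNat)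

@[simp] theorem rest_apply {n : ℕ} (k : Fin n) (q : Fin n → ℤ) (j : Fin n) :
    rest k q j = if j = k then 0 else (q j).toNat := rfl

theorem rest_add {n : ℕ} (c : ℕ) (k l : Fin n) (hkl : k < l) (q : Fin n → ℤ) (hq : ∀ j, 0 ≤ q j)
    (i : ℕ) : rest k (q + (i : ℤ) • dir c k l) = rest k q + Finsupp.single l (c * i) := by
  ext j
  have := hq j
  by_cases hjk : j = k
  · subst hjk
    simp [Finsupp.single_apply, hkl.ne']
  · by_cases hjl : j = l
    · subst hjl
      simp only [rest_apply, hjk, if_false, dir, Pi.add_apply, Pi.smul_apply, smul_eq_mul,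
        if_true, Finsupp.add_apply, Finsupp.single_eq_same]
      have : (i : ℤ) * c = ((c * i : ℕ) : ℤ) := by push_cast; ring
      rw [this]; omega
    · have hlj : ¬ l = j := fun h => hjl h.symm
      simp [rest_apply, hjk, dir, hjl, Finsupp.single_apply, hlj]

/-- `g^q` -/
noncomputable def G {n : ℕ} (c : ℕ) (k l : Fin n) (q : Fin n → ℤ) : MvPolynomial (Fin n) ℂ :=
  (X k + X l ^ c) ^ (q k).toNat * monomial (rest k q) 1

/-- The adapted basis. -/
noncomputable def F {n : ℕ} (c : ℕ) (k l : Fin n) (q : Fin n → ℤ) (a : ℤ) :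
    MvPolynomial (Fin n) ℂ :=
  (X k + X l ^ c) ^ a.toNat * X k ^ (q k - a).toNat * monomial (rest k q) 1

theorem mono_add {n : ℕ} (r : Fin n →₀ ℕ) (l : Fin n) (c i : ℕ) :
    (monomial (r + Finsupp.single l (c * i)) 1 : MvPolynomial (Fin n) ℂ)
      = (X l ^ c) ^ i * monomial r 1 := by
  rw [← pow_mul, X_pow_eq_monomial, monomial_mul, add_comm, one_mul]

theorem dir_k {n : ℕ} (c : ℕ) (k l : Fin n) : dir c k l k = -1 := by simp [dir]

theorem F_eq {n : ℕ} (c : ℕ) (k l : Fin n) (hkl : k < l) (q : Fin n → ℤ) (hq : ∀ j, 0 ≤ q j)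
    (a : ℤ) (ha : 0 ≤ a) (haq : a ≤ q k) :
    F c k l q a = ∑ i ∈ Finset.range ((q k - a).toNat + 1),
      ((-1) ^ i * ((q k - a).toNat.choose i : ℂ)) • G c k l (q + (i : ℤ) • dir c k l) := by
  have hX : (X k : MvPolynomial (Fin n) ℂ) = -(X l ^ c) + (X k + X l ^ c) := by ring
  unfold F
  conv_lhs => enter [1, 2]; rw [hX, add_pow]
  rw [Finset.mul_sum, Finset.sum_mul]
  refine Finset.sum_congr rfl fun i hi => ?_
  have hi' := Finset.mem_range.1 hi
  unfold G
  rw [rest_add c k l hkl q hq, mono_add]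
  have h1 : ((q + (i : ℤ) • dir c k l) k).toNat = a.toNat + ((q k - a).toNat - i) := by
    simp only [Pi.add_apply, Pi.smul_apply, dir_k, smul_eq_mul]; omega
  rw [h1, pow_add, neg_pow, smul_eq_C_mul]
  simp only [map_mul, map_pow, map_neg, map_one, map_natCast]
  ring

theorem G_eq {n : ℕ} (c : ℕ) (k l : Fin n) (hkl : k < l) (q : Fin n → ℤ) (hq : ∀ j, 0 ≤ q j)
    (a : ℤ) (ha : 0 ≤ a) (haq : a ≤ q k) :
    G c k l q = ∑ i ∈ Finset.range ((q k - a).toNat + 1),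
      ((q k - a).toNat.choose i : ℂ) • F c k l (q + (i : ℤ) • dir c k l) a := by
  have h0 : (q k).toNat = a.toNat + (q k - a).toNat := by omega
  unfold G
  rw [h0, pow_add]
  conv_lhs => enter [1, 2]; rw [add_comm, add_pow]
  rw [Finset.mul_sum, Finset.sum_mul]
  refine Finset.sum_congr rfl fun i hi => ?_
  have hi' := Finset.mem_range.1 hi
  unfold F
  rw [rest_add c k l hkl q hq, mono_add]
  have h1 : ((q + (i : ℤ) • dir c k l) k - a).toNat = (q k - a).toNat - i := by
    simp only [Pi.add_apply, Pi.smul_apply, dir_k, smul_eq_mul]; omega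
  rw [h1, smul_eq_C_mul]
  simp only [map_natCast]
  ring

/-- Exponents in `F`. -/
noncomputable def E {n : ℕ} (c : ℕ) (k l : Fin n) (q : Fin n → ℤ) (a : ℤ) (i : ℕ) : Fin n →₀ ℕ :=
  Finsupp.single k (i + (q k - a).toNat) + Finsupp.single l (c * (a.toNat - i)) + rest k q

theorem F_expand {n : ℕ} (c : ℕ) (k l : Fin n) (q : Fin n → ℤ) (a : ℤ) :
    F c k l q a = ∑ i ∈ Finset.range (a.toNat + 1),
      monomial (E c k l q a i) (a.toNat.choose i : ℂ) := by
  unfold F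
  rw [add_pow, Finset.sum_mul, Finset.sum_mul]
  refine Finset.sum_congr rfl fun i hi => ?_
  have : (monomial (E c k l q a i) (a.toNat.choose i : ℂ) : MvPolynomial (Fin n) ℂ)
      = C (a.toNat.choose i : ℂ) * (X k ^ (i + (q k - a).toNat) * X l ^ (c * (a.toNat - i))
        * monomial (rest k q) 1) := by
    rw [X_pow_eq_monomial, X_pow_eq_monomial, monomial_mul, monomial_mul, C_mul_monomial]
    simp [E]
  rw [this, pow_add, pow_mul, map_natCast]
  ring

theorem E_k {n : ℕ} (c : ℕ) (k l : Fin n) (hkl : k < l) (q : Fin n → ℤ) (a : ℤ) (i : ℕ) :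
    E c k l q a i k = i + (q k - a).toNat := by
  simp [E, Finsupp.single_apply, hkl.ne']

theorem E_lt {n : ℕ} (c : ℕ) (k l : Fin n) (hkl : k < l) (q : Fin n → ℤ) (a : ℤ) (i : ℕ)
    (hi : i ≠ 0) : toLex (E c k l q a 0) < toLex (E c k l q a i) := by
  refine Finsupp.Lex.lt_iff.2 ⟨k, fun j hj => ?_, ?_⟩
  · have h1 : ¬ k = j := hj.ne'
    have h2 : ¬ l = j := (hj.trans hkl).ne'
    simp [E, Finsupp.single_apply, h1, h2]
  · change E c k l q a 0 k < E c k l q a i k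
    rw [E_k _ _ _ hkl, E_k _ _ _ hkl]; omega

theorem F_coeff {n : ℕ} (c : ℕ) (k l : Fin n) (hkl : k < l) (q : Fin n → ℤ) (a : ℤ) :
    coeff (E c k l q a 0) (F c k l q a) = 1 := by
  classical
  rw [F_expand, coeff_sum, Finset.sum_eq_single 0]
  · simp
  · intro i _ hi
    rw [coeff_monomial, if_neg]
    intro h
    exact (E_lt c k l hkl q a i hi).ne (by rw [h])
  · intro h; simp at h

theorem F_supp {n : ℕ} (c : ℕ) (k l : Fin n) (hkl : k < l) (q : Fin n → ℤ) (a : ℤ)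
    (m : Fin n →₀ ℕ) (hm : m ∈ (F c k l q a).support) : toLex (E c k l q a 0) ≤ toLex m := by
  classical
  rw [mem_support_iff, F_expand, coeff_sum] at hm
  obtain ⟨i, _, hi⟩ := Finset.exists_ne_zero_of_sum_ne_zero hm
  rw [coeff_monomial] at hi
  have : E c k l q a i = m := by
    by_contra h; exact hi (if_neg h)
  rw [← this]
  by_cases h0 : i = 0
  · rw [h0]
  · exact (E_lt c k l hkl q a i h0).le

theorem E_cast {n : ℕ} (c : ℕ) (k l : Fin n) (hkl : k < l) (q : Fin n → ℤ) (hq : ∀ j, 0 ≤ q j)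
    (a : ℤ) (ha : 0 ≤ a) (haq : a ≤ q k) :
    (fun j => ((E c k l q a 0 j : ℕ) : ℤ)) = q + a • dir c k l := by
  funext j
  have := hq j
  by_cases hjk : j = k
  · subst hjk
    rw [E_k _ _ _ hkl]
    simp only [Pi.add_apply, Pi.smul_apply, dir_k, smul_eq_mul]; omega
  · have hkj : ¬ k = j := fun h => hjk h.symm
    by_cases hjl : j = l
    · subst hjl
      simp [E, Finsupp.single_apply, hjk, hkj, dir, ha, this]
      ring
    · have hlj : ¬ l = j := fun h => hjl h.symm
      simp [E, Finsupp.single_apply, hjk, hkj, dir, hjl, hlj, this]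

theorem prod_eq_G {n : ℕ} (c : ℕ) (k l : Fin n) (p : Fin n → ℕ) :
    (∏ j, (if j = k then X k + X l ^ c else X j : MvPolynomial (Fin n) ℂ) ^ p j)
      = G c k l (fun i => (p i : ℤ)) := by
  classical
  unfold G
  rw [← Finset.mul_prod_erase _ _ (Finset.mem_univ k), monomial_eq,
    Finsupp.prod_fintype _ _ (by simp),
    ← Finset.mul_prod_erase (Finset.univ) (fun i => X i ^ rest k (fun i => (p i : ℤ)) i)
      (Finset.mem_univ k)]
  simp only [if_true, rest_apply, pow_zero, one_mul, map_one, Int.toNat_natCast]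
  congr 1
  refine Finset.prod_congr rfl fun j hj => ?_
  have := Finset.ne_of_mem_erase hj
  simp [this]

end Slide

/-- Let `P ⊆ (ℝ≥0)ⁿ` be a smooth full-dimensional lattice polytope coinciding with the
positive orthant near the origin.  For `c ∈ ℕ`, `k < ℓ`, set `g_k = u_k + u_ℓ^c`,
`g_j = u_j (j ≠ k)`, and let `V` be the span of the `g^p`, `p ∈ P ∩ ℤⁿ`.  Then the set of
lexicographically least supports of nonzero elements of `V` is `ℱ_{-e_k+c e_ℓ}(P ∩ ℤⁿ)`. -/
theorem stmt_3 (n : ℕ) (hn : 2 ≤ n) (P : Set (Fin n → ℝ))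
    -- `P` is the convex hull of finitely many lattice points (lattice polytope)
    (hlattice : ∃ Vert : Finset (Fin n → ℤ),
      P = convexHull ℝ ((fun q : Fin n → ℤ => fun i => (q i : ℝ)) '' ↑Vert))
    -- `P` is full-dimensional
    (hfull : (interior P).Nonempty)
    -- `P ⊆ (ℝ≥0)ⁿ`
    (hnonneg : P ⊆ {x | ∀ i, 0 ≤ x i})
    -- smoothness: near each vertex, `P` is a unimodular image of the positive orthant
    (hsmooth : ∀ v ∈ Set.extremePoints ℝ P, ∃ M : Matrix (Fin n) (Fin n) ℤ,
      (M.det = 1 ∨ M.det = -1) ∧ ∃ ε : ℝ, 0 < ε ∧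
        P ∩ Metric.ball v ε =
          {x | ∃ y : Fin n → ℝ, (∀ i, 0 ≤ y i) ∧
            x = v + fun i => ∑ j, (M i j : ℝ) * y j} ∩ Metric.ball v ε)
    -- `P` coincides with the positive orthant in a neighborhood of the origin
    (horigin : ∃ ε : ℝ, 0 < ε ∧
      P ∩ Metric.ball 0 ε = {x | ∀ i, 0 ≤ x i} ∩ Metric.ball 0 ε)
    (c : ℕ) (k l : Fin n) (hkl : k < l)
    (g : Fin n → MvPolynomial (Fin n) ℂ)
    (hg : g = fun j => if j = k then X k + X l ^ c else X j)
    (V : Submodule ℂ (MvPolynomial (Fin n) ℂ))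
    (hV : V = Submodule.span ℂ
      {f | ∃ p : Fin n → ℕ, (fun i => (p i : ℝ)) ∈ P ∧ f = ∏ j, g j ^ p j}) :
    {x : Fin n → ℤ | ∃ f ∈ V, f ≠ 0 ∧ ∃ m ∈ f.support,
        (∀ m' ∈ f.support, lexLe m m') ∧ x = fun i => (m i : ℤ)} =
      slide (fun i => if i = k then -1 else if i = l then (c : ℤ) else 0) k
        {q : Fin n → ℤ | (fun i => (q i : ℝ)) ∈ P} := by
  classical
  have hconv : Convex ℝ P := by
    obtain ⟨Vert, rfl⟩ := hlattice
    exact convex_convexHull ℝ _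
  change _ = slide (Slide.dir c k l) k _
  set S : Set (Fin n → ℤ) := {q : Fin n → ℤ | (fun i => (q i : ℝ)) ∈ P} with hS
  have hS0 : ∀ q ∈ S, ∀ j, 0 ≤ q j := fun q hq j => by
    have := hnonneg hq j
    exact_mod_cast this
  -- the minimal `k`-coordinate
  set a : (Fin n → ℤ) → ℤ := fun q => sInf (Slide.lineSet (Slide.dir c k l) k S q) with ha
  have haL : ∀ q ∈ S, IsLeast (Slide.lineSet (Slide.dir c k l) k S q) (a q) := by
    intro q hq
    have hb : BddBelow (Slide.lineSet (Slide.dir c k l) k S q) := by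
      refine ⟨0, ?_⟩
      rintro t ⟨q', hq', _, rfl⟩
      exact hS0 q' hq' k
    exact ⟨Int.csInf_mem ⟨q k, q, hq, ⟨0, by simp⟩, rfl⟩ hb, fun t ht => csInf_le hb ht⟩
  have ha0 : ∀ q ∈ S, 0 ≤ a q := by
    intro q hq
    obtain ⟨q', hq', _, h⟩ := (haL q hq).1
    rw [h]; exact hS0 q' hq' k
  have hak : ∀ q ∈ S, a q ≤ q k := fun q hq => (haL q hq).2 ⟨q, hq, ⟨0, by simp⟩, rfl⟩
  have hadd : ∀ q (i : ℤ), a (q + i • Slide.dir c k l) = a q := by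
    intro q i
    simp only [ha, Slide.lineSet_add]
  -- contiguity
  have hmem : ∀ q ∈ S, ∀ i : ℕ, i ∈ Finset.range ((q k - a q).toNat + 1) →
      q + (i : ℤ) • Slide.dir c k l ∈ S := by
    intro q hq i hi
    have hi' := Finset.mem_range.1 hi
    have hk := hak q hq
    obtain ⟨q', hq', ⟨b, hb⟩, h⟩ := (haL q hq).1
    have hbk : q' k - q k = -b := by
      have := congrFun hb k
      simpa [Slide.dir_k] using this
    by_cases hi0 : i = 0
    · subst hi0; simpa using hq
    have hbi : (i : ℤ) ≤ b := by omega
    have hb0 : (0 : ℤ) < b := by omega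
    have hbR : (0 : ℝ) < b := by exact_mod_cast hb0
    have hbiR : (i : ℝ) ≤ b := by exact_mod_cast hbi
    have hcv := hconv hq hq' (a := 1 - (i : ℝ) / b) (b := (i : ℝ) / b)
      (by rw [sub_nonneg, div_le_one hbR]; exact hbiR) (by positivity) (by ring)
    have : (fun j => ((q + (i : ℤ) • Slide.dir c k l) j : ℝ))
        = (1 - (i : ℝ) / b) • (fun j => (q j : ℝ)) + ((i : ℝ) / b) • (fun j => (q' j : ℝ)) := by
      funext j
      have h1 : q' j = q j + b * Slide.dir c k l j := by
        have := congrFun hb j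
        simp only [Pi.sub_apply, Pi.smul_apply, smul_eq_mul] at this
        linarith
      simp only [Pi.add_apply, Pi.smul_apply, smul_eq_mul, h1]
      push_cast
      field_simp
      ring
    change (fun j => ((q + (i : ℤ) • Slide.dir c k l) j : ℝ)) ∈ P
    rw [this]; exact hcv
  -- the generators
  have hVG : V = Submodule.span ℂ (Slide.G c k l '' S) := by
    rw [hV]
    congr 1
    ext f
    constructor
    · rintro ⟨p, hp, rfl⟩
      refine ⟨fun i => (p i : ℤ), by simpa [hS] using hp, ?_⟩
      rw [hg, Slide.prod_eq_G]
    · rintro ⟨q, hq, rfl⟩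
      have hqq : (fun i => ((q i).toNat : ℤ)) = q := by
        funext i; exact Int.toNat_of_nonneg (hS0 q hq i)
      refine ⟨fun i => (q i).toNat, ?_, ?_⟩
      · have h2 : (fun i => (((q i).toNat : ℕ) : ℝ)) = fun i => (q i : ℝ) := by
          funext i
          have := congrFun hqq i
          exact_mod_cast congrArg (Int.cast : ℤ → ℝ) this
        rw [h2]; exact hq
      · rw [hg, Slide.prod_eq_G, hqq]
  have hFV : ∀ q ∈ S, Slide.F c k l q (a q) ∈ V := by
    intro q hq
    rw [Slide.F_eq c k l hkl q (hS0 q hq) _ (ha0 q hq) (hak q hq), hVG]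
    exact Submodule.sum_mem _ fun i hi => Submodule.smul_mem _ _
      (Submodule.subset_span ⟨_, hmem q hq i hi, rfl⟩)
  have hVF : V ≤ Submodule.span ℂ ((fun q => Slide.F c k l q (a q)) '' S) := by
    rw [hVG, Submodule.span_le]
    rintro _ ⟨q, hq, rfl⟩
    rw [Slide.G_eq c k l hkl q (hS0 q hq) _ (ha0 q hq) (hak q hq)]
    refine Submodule.sum_mem _ fun i hi => Submodule.smul_mem _ _
      (Submodule.subset_span ⟨_, hmem q hq i hi, ?_⟩)
    simp only [hadd]
  have hcast : ∀ q ∈ S, (fun j => ((Slide.E c k l q (a q) 0 j : ℕ) : ℤ))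
      = q + a q • Slide.dir c k l := fun q hq =>
    Slide.E_cast c k l hkl q (hS0 q hq) _ (ha0 q hq) (hak q hq)
  have hinj : Set.InjOn (fun q => Slide.E c k l q (a q) 0) S := by
    intro q hq q' hq' h
    have h' : Slide.E c k l q (a q) 0 = Slide.E c k l q' (a q') 0 := h
    have h1 : q + a q • Slide.dir c k l = q' + a q' • Slide.dir c k l := by
      rw [← hcast q hq, ← hcast q' hq', h']
    have h2 : a q = a q' := by
      rw [← hadd q (a q), h1, hadd]
    rw [h2] at h1
    exact add_right_cancel h1
  ext x
  constructor
  · rintro ⟨f, hf, hf0, m, hm, hmin, rfl⟩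
    obtain ⟨q, hq, hq1, hq2⟩ := Slide.lexmin_comb S (fun q => Slide.F c k l q (a q))
      (fun q => Slide.E c k l q (a q) 0) hinj
      (fun q _ => by rw [Slide.F_coeff c k l hkl]; exact one_ne_zero)
      (fun q _ m hm => Slide.F_supp c k l hkl q (a q) m hm) f (hVF hf) hf0
    have hme : m = Slide.E c k l q (a q) 0 := toLex.injective
      (le_antisymm (Slide.le_of_lexLe (hmin _ (mem_support_iff.2 hq1))) (hq2 m hm))
    refine ⟨q, hq, a q, haL q hq, ?_⟩
    rw [hme]; exact hcast q hq
  · rintro ⟨q, hq, b, hb, rfl⟩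
    have hba : b = a q := hb.unique (haL q hq)
    subst hba
    have hne : coeff (Slide.E c k l q (a q) 0) (Slide.F c k l q (a q)) ≠ 0 := by
      rw [Slide.F_coeff c k l hkl]; exact one_ne_zero
    refine ⟨_, hFV q hq, ?_, _, mem_support_iff.2 hne, fun m' hm' =>
      Slide.lexLe_of_le (Slide.F_supp c k l hkl q (a q) m' hm'), (hcast q hq).symm⟩
    intro h
    rw [h, coeff_zero] at hne
    exact hne rfl
end

section
/- Let A ∈ ℤ, let c be a positive integer, and let λ₁, λ₂ be positive real numbers with λ₂ − c·λ₁ > 0. Let Δ = {p ∈ ℝ² : 0 ≤ p₁ ≤ λ₁, 0 ≤ p₂, p₂ + A·p₁ ≤ λ₂}. Then conv(ℱ_{(−1,c)}(Δ ∩ ℤ²)) ∩ ℤ² = ℱ_{(−1,c)}(Δ ∩ ℤ²), i.e., every lattice point of the convex hull of the slid set of lattice points of Δ already belongs to the slid set. -/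
/-- The sliding operator `ℱ_{(−1,c)}` on subsets of `ℤ²`:  each point `q` of `S` is moved to
`q + a_q·(−1,c)`, where `a_q` is the minimum of the first coordinates of the points of `S`
lying on the affine line through `q` in direction `(−1,c)`. -/
def slide2 (c : ℤ) (S : Set (Fin 2 → ℤ)) : Set (Fin 2 → ℤ) :=
  {y | ∃ q ∈ S, ∃ a : ℤ,
    IsLeast {t : ℤ | ∃ q' ∈ S, (∃ b : ℤ, q' - q = b • ![(-1 : ℤ), c]) ∧ t = q' 0} a ∧
    y = q + a • ![(-1 : ℤ), c]}

theorem slide2_big (A c L M : ℤ) (hA : c ≤ A) (S : Set (Fin 2 → ℤ))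
    (hS : ∀ q, q ∈ S ↔ 0 ≤ q 0 ∧ q 0 ≤ L ∧ 0 ≤ q 1 ∧ q 1 + A * q 0 ≤ M) (hc : 0 < c) :
    slide2 c S = S := by
  have key : ∀ q ∈ S,
      IsLeast {t : ℤ | ∃ q' ∈ S, (∃ b : ℤ, q' - q = b • ![(-1 : ℤ), c]) ∧ t = q' 0} 0 := by
    intro q hq
    obtain ⟨h1, h2, h3, h4⟩ := (hS q).1 hq
    constructor
    · refine ⟨![0, q 1 + c * q 0], (hS _).2 ?_, ⟨q 0, ?_⟩, by simp⟩
      · simp only [Matrix.cons_val_zero, Matrix.cons_val_one]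
        refine ⟨le_refl _, by omega, by positivity, by nlinarith⟩
      · ext i
        fin_cases i
        · simp
        · simp
          ring
    · rintro t ⟨q', hq', -, rfl⟩
      exact ((hS q').1 hq').1
  ext y
  constructor
  · rintro ⟨q, hq, a, ha, rfl⟩
    rw [ha.unique (key q hq)]
    simpa using hq
  · intro hy
    exact ⟨y, hy, 0, key y hy, by simp⟩

theorem slide2_small (A c L M : ℤ) (hA : A < c) (S : Set (Fin 2 → ℤ))
    (hS : ∀ q, q ∈ S ↔ 0 ≤ q 0 ∧ q 0 ≤ L ∧ 0 ≤ q 1 ∧ q 1 + A * q 0 ≤ M) (hc : 0 < c)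
    (hM : c * L ≤ M) (y : Fin 2 → ℤ) :
    y ∈ slide2 c S ↔ 0 ≤ y 0 ∧ y 0 ≤ L ∧ 0 ≤ y 1 ∧
      (2 * c - A) * y 0 + y 1 ≤ (c - A) * L + M := by
  constructor
  · rintro ⟨q, hq, a, ⟨⟨q', hq', ⟨b, hb⟩, rfl⟩, hmin⟩, rfl⟩
    obtain ⟨h1, h2, h3, h4⟩ := (hS q).1 hq
    obtain ⟨g1, g2, g3, g4⟩ := (hS q').1 hq'
    have hle : q' 0 ≤ q 0 := hmin ⟨q, hq, ⟨0, by simp⟩, rfl⟩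
    have e0 := congrFun hb 0
    have e1 := congrFun hb 1
    simp at e0 e1 ⊢
    have e2 : q' 1 = q 1 + (q 0 - q' 0) * c := by
      have : b = q 0 - q' 0 := by linarith
      rw [← this]; linarith
    refine ⟨by omega, by omega, by positivity, ?_⟩
    rw [e2] at g4
    nlinarith [mul_le_mul_of_nonneg_left h2 (by omega : 0 ≤ c - A)]
  · rintro ⟨h1, h2, h3, h4⟩
    have hd : 0 ≤ c - A := by omega
    obtain ⟨a, ⟨ha0, hak⟩, hamin⟩ := Int.exists_least_of_bdd
      (P := fun a => 0 ≤ a ∧ c * y 0 + y 1 ≤ M + (c - A) * a)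
      ⟨0, fun z hz => hz.1⟩ ⟨L - y 0, by omega, by nlinarith⟩
    have haL : a ≤ L - y 0 := hamin _ ⟨by omega, by nlinarith⟩
    have hq1 : 0 ≤ y 1 - a * c := by
      rcases ha0.eq_or_lt with h0 | h0
      · rw [← h0]; simpa using h3
      · have : ¬ (c * y 0 + y 1 ≤ M) := by
          intro hh
          have := hamin 0 ⟨le_refl _, by simpa using hh⟩
          omega
        nlinarith
    refine ⟨![y 0 + a, y 1 - a * c], (hS _).2 ?_, a, ⟨?_, ?_⟩, ?_⟩
    · simp only [Matrix.cons_val_zero, Matrix.cons_val_one]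
      refine ⟨by omega, by omega, hq1, by nlinarith [mul_nonneg hd h1]⟩
    · refine ⟨![a, y 1 - a * c + y 0 * c], (hS _).2 ?_, ⟨y 0, ?_⟩, by simp⟩
      · simp only [Matrix.cons_val_zero, Matrix.cons_val_one]
        refine ⟨by omega, by omega, by positivity, by nlinarith⟩
      · ext i
        fin_cases i <;> simp
    · rintro t ⟨q', hq', ⟨b, hb⟩, rfl⟩
      obtain ⟨g1, g2, g3, g4⟩ := (hS q').1 hq'
      have e0 := congrFun hb 0
      have e1 := congrFun hb 1
      simp at e0 e1
      refine hamin _ ⟨g1, ?_⟩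
      have : b = y 0 + a - q' 0 := by linarith
      subst this
      nlinarith
    · ext i
      fin_cases i <;> simp

theorem hull_lattice (T : Set (Fin 2 → ℤ)) (L : ℤ) (B N : ℤ)
    (hT : ∀ q, q ∈ T ↔ 0 ≤ q 0 ∧ q 0 ≤ L ∧ 0 ≤ q 1 ∧ B * q 0 + q 1 ≤ N) :
    {q : Fin 2 → ℤ | (fun i => (q i : ℝ)) ∈
        convexHull ℝ ((fun q : Fin 2 → ℤ => fun i => (q i : ℝ)) '' T)} = T := by
  ext q
  constructor
  · intro hq
    have hK : Convex ℝ {p : Fin 2 → ℝ | 0 ≤ p 0 ∧ p 0 ≤ L ∧ 0 ≤ p 1 ∧ B * p 0 + p 1 ≤ N} := by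
      rintro x ⟨x1, x2, x3, x4⟩ y ⟨y1, y2, y3, y4⟩ s t hs ht hst
      have e : s = 1 - t := by linarith
      simp only [Set.mem_ofPred_eq, Pi.add_apply, Pi.smul_apply, smul_eq_mul]
      refine ⟨by positivity, ?_, by positivity, ?_⟩
      · have := mul_le_mul_of_nonneg_left x2 hs
        have := mul_le_mul_of_nonneg_left y2 ht
        subst e
        linarith
      · have := mul_le_mul_of_nonneg_left x4 hs
        have := mul_le_mul_of_nonneg_left y4 ht
        subst e
        linarith
    have := convexHull_min (s := (fun q : Fin 2 → ℤ => fun i => (q i : ℝ)) '' T) ?_ hK hq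
    · obtain ⟨a1, a2, a3, a4⟩ := this
      beta_reduce at a1 a2 a3 a4
      refine (hT q).2 ⟨?_, ?_, ?_, ?_⟩
      · exact_mod_cast a1
      · exact_mod_cast a2
      · exact_mod_cast a3
      · exact_mod_cast a4
    · rintro _ ⟨r, hr, rfl⟩
      obtain ⟨a1, a2, a3, a4⟩ := (hT r).1 hr
      refine ⟨?_, ?_, ?_, ?_⟩
      · beta_reduce
        exact_mod_cast a1
      · beta_reduce
        exact_mod_cast a2
      · beta_reduce
        exact_mod_cast a3
      · beta_reduce
        exact_mod_cast a4
  · intro hq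
    exact subset_convexHull ℝ _ ⟨q, hq, rfl⟩

/-- For the trapezoid `Δ = {0 ≤ p₁ ≤ λ₁, 0 ≤ p₂, p₂ + A·p₁ ≤ λ₂}` with `λ₂ − c·λ₁ > 0`,
every lattice point of `conv(ℱ_{(−1,c)}(Δ ∩ ℤ²))` lies in `ℱ_{(−1,c)}(Δ ∩ ℤ²)`. -/
theorem stmt_4 (A : ℤ) (c : ℤ) (hc : 0 < c) (l1 l2 : ℝ) (hl1 : 0 < l1) (hl2 : 0 < l2)
    (h : l2 - (c : ℝ) * l1 > 0)
    (Δ : Set (Fin 2 → ℝ))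
    (hΔ : Δ = {p | 0 ≤ p 0 ∧ p 0 ≤ l1 ∧ 0 ≤ p 1 ∧ p 1 + (A : ℝ) * p 0 ≤ l2})
    (S : Set (Fin 2 → ℤ)) (hS : S = {q | (fun i => (q i : ℝ)) ∈ Δ}) :
    {q : Fin 2 → ℤ | (fun i => (q i : ℝ)) ∈
        convexHull ℝ ((fun q : Fin 2 → ℤ => fun i => (q i : ℝ)) '' slide2 c S)} =
      slide2 c S := by
  have hS' : ∀ q, q ∈ S ↔ 0 ≤ q 0 ∧ q 0 ≤ ⌊l1⌋ ∧ 0 ≤ q 1 ∧ q 1 + A * q 0 ≤ ⌊l2⌋ := by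
    intro q
    subst hS hΔ
    simp only [Set.mem_ofPred_eq, Int.le_floor]
    push_cast
    simp
  have hM : c * ⌊l1⌋ ≤ ⌊l2⌋ := by
    rw [Int.le_floor]
    push_cast
    have h1 : (0 : ℝ) < c := by exact_mod_cast hc
    nlinarith [Int.floor_le l1]
  rcases le_or_gt c A with hA | hA
  · rw [slide2_big A c _ _ hA S hS' hc]
    exact hull_lattice S ⌊l1⌋ A ⌊l2⌋ (fun q => by rw [hS' q, add_comm (q 1)])
  · exact hull_lattice _ ⌊l1⌋ (2 * c - A) ((c - A) * ⌊l1⌋ + ⌊l2⌋)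
      (slide2_small A c _ _ hA S hS' hc hM)
end

section
/- Let A ∈ ℤ, let c be a positive integer, and let λ₁, λ₂ be positive integers with λ₂ − c·λ₁ > 0 and λ₂ − A·λ₁ > 0. Let Δ(A, λ₁, λ₂) = {p ∈ ℝ² : 0 ≤ p₁ ≤ λ₁, 0 ≤ p₂, p₂ + A·p₁ ≤ λ₂}. Then: if c > A, the convex hull of ℱ_{(−1,c)}(Δ(A,λ₁,λ₂) ∩ ℤ²) equals the trapezoid Δ(2c−A, λ₁, λ₂ + (c−A)·λ₁) = {p ∈ ℝ² : 0 ≤ p₁ ≤ λ₁, 0 ≤ p₂, p₂ + (2c−A)·p₁ ≤ λ₂ + (c−A)·λ₁}; and if c ≤ A, the convex hull of ℱ_{(−1,c)}(Δ(A,λ₁,λ₂) ∩ ℤ²) equals Δ(A, λ₁, λ₂) itself. -/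
/-- The trapezoid `Δ(A, λ₁, λ₂) = {p ∈ ℝ² : 0 ≤ p₁ ≤ λ₁, 0 ≤ p₂, p₂ + A·p₁ ≤ λ₂}`. -/
def trapezoid (A l1 l2 : ℤ) : Set (Fin 2 → ℝ) :=
  {p | 0 ≤ p 0 ∧ p 0 ≤ (l1 : ℝ) ∧ 0 ≤ p 1 ∧ p 1 + (A : ℝ) * p 0 ≤ (l2 : ℝ)}

lemma slide2_intro (c : ℤ) (S : Set (Fin 2 → ℤ)) (x y a : ℤ) (h1 : ![x, y] ∈ S)
    (h2 : ![a, y + c * (x - a)] ∈ S) (h3 : ∀ x', ![x', y + c * (x - x')] ∈ S → a ≤ x') :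
    ![x - a, y + c * a] ∈ slide2 c S := by
  refine ⟨![x, y], h1, a, ⟨⟨_, h2, ⟨x - a, ?_⟩, by simp⟩, ?_⟩, ?_⟩
  · ext i; fin_cases i <;> simp <;> ring
  · rintro t ⟨q', hq', ⟨b, hb⟩, rfl⟩
    apply h3
    have e0 := congrFun hb 0
    have e1 := congrFun hb 1
    simp at e0 e1
    convert hq' using 1
    ext i; fin_cases i
    · simp
    · simp
      have : b = x - q' 0 := by linarith
      rw [← this]; linarith
  · ext i; fin_cases i <;> simp <;> ring

lemma slide2_elim (c : ℤ) (S : Set (Fin 2 → ℤ)) (z : Fin 2 → ℤ) (hz : z ∈ slide2 c S) :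
    ∃ x y a : ℤ, ![x, y] ∈ S ∧ ![a, y + c * (x - a)] ∈ S ∧
      (∀ x', ![x', y + c * (x - x')] ∈ S → a ≤ x') ∧ z = ![x - a, y + c * a] := by
  obtain ⟨q, hq, a, ⟨⟨q', hq', ⟨b, hb⟩, hqa⟩, hmin⟩, rfl⟩ := hz
  have e0 := congrFun hb 0
  have e1 := congrFun hb 1
  simp at e0 e1
  refine ⟨q 0, q 1, a, ?_, ?_, ?_, ?_⟩
  · convert hq using 1
    ext i; fin_cases i <;> simp
  · convert hq' using 1
    have : b = q 0 - a := by linarith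
    rw [← this]
    ext i; fin_cases i
    · simp [hqa]
    · simp; linarith
  · intro x' hx'
    refine hmin ⟨_, hx', ⟨q 0 - x', ?_⟩, by simp⟩
    ext i; fin_cases i <;> simp <;> ring
  · ext i; fin_cases i <;> simp <;> ring

lemma trapezoid_convex (A l1 l2 : ℤ) : Convex ℝ (trapezoid A l1 l2) := by
  rintro p ⟨p1, p2, p3, p4⟩ q ⟨q1, q2, q3, q4⟩ s t hs ht hst
  have e : t = 1 - s := by linarith
  refine ⟨?_, ?_, ?_, ?_⟩ <;> simp only [Pi.add_apply, Pi.smul_apply, smul_eq_mul]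
  · positivity
  · nlinarith
  · positivity
  · have := mul_le_mul_of_nonneg_left p4 hs
    have := mul_le_mul_of_nonneg_left q4 ht
    have e2 : s * (l2 : ℝ) + t * l2 = l2 := by rw [← add_mul, hst, one_mul]
    linarith

lemma trapezoid_subset (B l1 L : ℤ) (hl1 : 0 < l1) (hL : 0 < L) (hB : 0 < L - B * l1)
    (C : Set (Fin 2 → ℝ)) (hC : Convex ℝ C)
    (h00 : ![(0 : ℝ), 0] ∈ C) (h10 : ![(l1 : ℝ), 0] ∈ C) (h01 : ![(0 : ℝ), (L : ℝ)] ∈ C)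
    (h11 : ![(l1 : ℝ), (L : ℝ) - B * l1] ∈ C) : trapezoid B l1 L ⊆ C := by
  rintro p ⟨p1, p2, p3, p4⟩
  have r1 : (0 : ℝ) < l1 := by exact_mod_cast hl1
  have rL : (0 : ℝ) < L := by exact_mod_cast hL
  have rB : (0 : ℝ) < L - B * l1 := by exact_mod_cast hB
  obtain ⟨s, hs⟩ : ∃ s : ℝ, s = p 0 / l1 := ⟨_, rfl⟩
  have hs0 : 0 ≤ s := by rw [hs]; positivity
  have hs1 : 0 ≤ 1 - s := by rw [hs, sub_nonneg, div_le_one r1]; exact p2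
  have hps : p 0 = s * l1 := by rw [hs]; field_simp
  have hh : (0 : ℝ) < L - B * p 0 := by
    have e : (L : ℝ) - B * p 0 = (1 - s) * L + s * (L - B * l1) := by rw [hps]; ring
    rw [e]
    rcases hs0.eq_or_lt with h | h
    · rw [← h]; linarith
    · have := mul_pos h rB
      have := mul_nonneg hs1 rL.le
      linarith
  obtain ⟨t, ht⟩ : ∃ t : ℝ, t = p 1 / (L - B * p 0) := ⟨_, rfl⟩
  have ht0 : 0 ≤ t := by rw [ht]; positivity
  have ht1 : 0 ≤ 1 - t := by rw [ht, sub_nonneg, div_le_one hh]; linarith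
  have hpt : p 1 = t * (L - B * p 0) := by rw [ht]; field_simp
  have k0 := hC h00 h10 hs1 hs0 (by ring)
  have k1 := hC h01 h11 hs1 hs0 (by ring)
  have k := hC k0 k1 ht1 ht0 (by ring)
  convert k using 1
  ext i; fin_cases i
  · simp [hps]; ring
  · simp [hpt, hps]; left; ring

theorem stmt_5 (A : ℤ) (c : ℤ) (hc : 0 < c) (l1 l2 : ℤ) (hl1 : 0 < l1) (hl2 : 0 < l2)
    (h : l2 - c * l1 > 0) (h' : l2 - A * l1 > 0)
    (S : Set (Fin 2 → ℤ)) (hS : S = {q | (fun i => (q i : ℝ)) ∈ trapezoid A l1 l2}) :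
    (c > A →
      convexHull ℝ ((fun q : Fin 2 → ℤ => fun i => (q i : ℝ)) '' slide2 c S) =
        trapezoid (2 * c - A) l1 (l2 + (c - A) * l1)) ∧
    (c ≤ A →
      convexHull ℝ ((fun q : Fin 2 → ℤ => fun i => (q i : ℝ)) '' slide2 c S) =
        trapezoid A l1 l2) := by
  have mS : ∀ x y : ℤ, ![x, y] ∈ S ↔ 0 ≤ x ∧ x ≤ l1 ∧ 0 ≤ y ∧ y + A * x ≤ l2 := by
    intro x y
    rw [hS]
    simp only [trapezoid, Set.mem_ofPred_eq, Matrix.cons_val_zero, Matrix.cons_val_one]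
    norm_cast
  have mT : ∀ B L x y : ℤ, 0 ≤ x → x ≤ l1 → 0 ≤ y → y + B * x ≤ L →
      (fun i => ((![x, y] : Fin 2 → ℤ) i : ℝ)) ∈ trapezoid B l1 L := by
    intro B L x y a1 a2 a3 a4
    simp only [trapezoid, Set.mem_ofPred_eq, Matrix.cons_val_zero, Matrix.cons_val_one]
    norm_cast
  have mC : ∀ (x y a : ℤ) (u v : ℝ), ![x, y] ∈ S → ![a, y + c * (x - a)] ∈ S →
      (∀ x', ![x', y + c * (x - x')] ∈ S → a ≤ x') → u = ((x - a : ℤ) : ℝ) →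
      v = ((y + c * a : ℤ) : ℝ) → ![u, v] ∈
      convexHull ℝ ((fun q : Fin 2 → ℤ => fun i => (q i : ℝ)) '' slide2 c S) := by
    intro x y a u v a1 a2 a3 hu hv
    apply subset_convexHull
    refine ⟨_, slide2_intro c S x y a a1 a2 a3, ?_⟩
    rw [hu, hv]
    ext i; fin_cases i <;> simp
  have m0 : ∀ (x y : ℤ), ∀ x', ![x', y + c * (x - x')] ∈ S → 0 ≤ x' :=
    fun x y x' hx' => ((mS _ _).1 hx').1
  have hcl : 0 < c * l1 := mul_pos hc hl1
  constructor
  · intro hcA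
    have hd : 0 < (c - A) * l1 := mul_pos (by linarith) hl1
    apply subset_antisymm
    · apply convexHull_min _ (trapezoid_convex _ _ _)
      rintro _ ⟨z, hz, rfl⟩
      obtain ⟨x, y, a, b1, b2, b3, rfl⟩ := slide2_elim c S z hz
      have hax : a ≤ x := b3 x (by simpa using b1)
      rw [mS] at b1 b2
      obtain ⟨x1, x2, x3, x4⟩ := b1
      obtain ⟨y1, y2, y3, y4⟩ := b2
      have := mul_nonneg hc.le y1
      have := mul_le_mul_of_nonneg_left x2 (sub_pos.2 hcA).le
      exact mT _ _ _ _ (by linarith) (by linarith) (by linarith) (by linarith)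
    · apply trapezoid_subset _ _ _ hl1 (by linarith) (by linarith) _ (convex_convexHull ℝ _)
      · refine mC 0 0 0 _ _ ?_ ?_ (m0 _ _) (by simp) (by simp) <;> rw [mS] <;>
          refine ⟨?_, ?_, ?_, ?_⟩ <;> linarith
      · refine mC l1 0 0 _ _ ?_ ?_ (m0 _ _) (by simp) (by simp) <;> rw [mS] <;>
          refine ⟨?_, ?_, ?_, ?_⟩ <;> linarith
      · refine mC l1 (l2 - A * l1) l1 _ _ ?_ ?_ ?_ (by simp) (by push_cast; ring)
        · rw [mS]; refine ⟨?_, ?_, ?_, ?_⟩ <;> linarith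
        · rw [mS]; refine ⟨?_, ?_, ?_, ?_⟩ <;> linarith
        · intro x' hx'
          rw [mS] at hx'
          have : (c - A) * l1 ≤ (c - A) * x' := by linarith [hx'.2.2.2]
          exact le_of_mul_le_mul_left this (by linarith)
      · refine mC l1 (l2 - c * l1) 0 _ _ ?_ ?_ (m0 _ _) (by simp) (by push_cast; ring) <;> rw [mS] <;>
          refine ⟨?_, ?_, ?_, ?_⟩ <;> linarith
  · intro hcA
    have hd : 0 ≤ (A - c) * l1 := mul_nonneg (by linarith) hl1.le
    apply subset_antisymm
    · apply convexHull_min _ (trapezoid_convex _ _ _)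
      rintro _ ⟨z, hz, rfl⟩
      obtain ⟨x, y, a, b1, b2, b3, rfl⟩ := slide2_elim c S z hz
      rw [mS] at b1 b2
      obtain ⟨x1, x2, x3, x4⟩ := b1
      have := mul_nonneg hc.le x1
      have := mul_nonneg (sub_nonneg.2 hcA) x1
      have ha : a ≤ 0 := by
        apply b3
        rw [mS]; refine ⟨?_, ?_, ?_, ?_⟩ <;> linarith
      obtain rfl : a = 0 := le_antisymm ha b2.1
      exact mT _ _ _ _ (by linarith) (by linarith) (by linarith) (by linarith)
    · apply trapezoid_subset _ _ _ hl1 (by linarith) (by linarith) _ (convex_convexHull ℝ _)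
      · refine mC 0 0 0 _ _ ?_ ?_ (m0 _ _) (by simp) (by simp) <;> rw [mS] <;>
          refine ⟨?_, ?_, ?_, ?_⟩ <;> linarith
      · refine mC l1 0 0 _ _ ?_ ?_ (m0 _ _) (by simp) (by simp) <;> rw [mS] <;>
          refine ⟨?_, ?_, ?_, ?_⟩ <;> linarith
      · refine mC 0 l2 0 _ _ ?_ ?_ (m0 _ _) (by simp) (by simp) <;> rw [mS] <;>
          refine ⟨?_, ?_, ?_, ?_⟩ <;> linarith
      · refine mC l1 (l2 - A * l1) 0 _ _ ?_ ?_ (m0 _ _) (by simp) (by push_cast; ring) <;> rw [mS] <;>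
          refine ⟨?_, ?_, ?_, ?_⟩ <;> linarith
end

section
/- Let n ≥ 1. The ℚ-algebra homomorphism from ℚ[y₁,…,y_n] to ℚ[x₁,…,x_n]/⟨x₁² − x₁x_n, …, x_{n−1}² − x_{n−1}x_n, x_n²⟩ determined by y_i ↦ x_i − (1/2)·x_n for i < n and y_n ↦ x_n descends to a ℚ-algebra isomorphism ℚ[y₁,…,y_n]/⟨y₁², …, y_n²⟩ ≅ ℚ[x₁,…,x_n]/⟨x₁² − x₁x_n, …, x_{n−1}² − x_{n−1}x_n, x_n²⟩. In particular the rational cohomology ring of the Bott manifold ℋ(λ₁,…,λ_n) is isomorphic to that of a product of n copies of ℂP¹. -/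
open MvPolynomial

/-- The presentation ideal (over `ℚ`) of the cohomology of the standard `ℚ`-trivial Bott
manifold `ℋ(λ₁,…,λ_{n+1})`: `⟨x_i² − x_i·x_last (i ≠ last), x_last²⟩` in `n+1` variables. -/
noncomputable def qtrivIdealQ (n : ℕ) : Ideal (MvPolynomial (Fin (n + 1)) ℚ) :=
  Ideal.span (Set.range fun i : Fin (n + 1) =>
    if i = Fin.last n then X (Fin.last n) ^ 2 else X i ^ 2 - X i * X (Fin.last n))

/-- The ideal `⟨y₁², …, y_{n+1}²⟩` in `ℚ[y₁,…,y_{n+1}]`, the presentation ideal of the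
rational cohomology of `(ℂP¹)^{n+1}`. -/
noncomputable def prodIdealQ (n : ℕ) : Ideal (MvPolynomial (Fin (n + 1)) ℚ) :=
  Ideal.span (Set.range fun i : Fin (n + 1) => (X i : MvPolynomial (Fin (n + 1)) ℚ) ^ 2)

/-- Substitution `x_i ↦ x_i + c x_last` for `i ≠ last`, `x_last ↦ x_last`. -/
noncomputable def shearHom (n : ℕ) (c : ℚ) :
    MvPolynomial (Fin (n + 1)) ℚ →ₐ[ℚ] MvPolynomial (Fin (n + 1)) ℚ :=
  aeval fun i => if i = Fin.last n then X (Fin.last n) else X i + C c * X (Fin.last n)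

theorem shearHom_X (n : ℕ) (c : ℚ) (i : Fin (n + 1)) :
    shearHom n c (X i) =
      if i = Fin.last n then X (Fin.last n) else X i + C c * X (Fin.last n) := by
  simp [shearHom]

theorem shearHom_comp (n : ℕ) (c d : ℚ) (h : d + c = 0) (p : MvPolynomial (Fin (n + 1)) ℚ) :
    shearHom n c (shearHom n d p) = p := by
  have hC : (C d + C c : MvPolynomial (Fin (n + 1)) ℚ) = 0 := by rw [← C_add, h, C_0]
  have : (shearHom n c).comp (shearHom n d) = AlgHom.id ℚ _ := by
    apply MvPolynomial.algHom_ext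
    intro i
    have hCd : shearHom n c (C d) = C d := (shearHom n c).commutes d
    by_cases hi : i = Fin.last n
    · simp [shearHom_X, hi]
    · simp only [AlgHom.comp_apply, shearHom_X, hi, if_false, map_add, map_mul, hCd, if_true,
        AlgHom.id_apply]
      linear_combination X (Fin.last n) * hC
  exact DFunLike.congr_fun this p

theorem shear_prod_le (n : ℕ) :
    prodIdealQ n ≤ (qtrivIdealQ n).comap (shearHom n (-(1 / 2))) := by
  unfold prodIdealQ
  rw [Ideal.span_le]
  rintro _ ⟨i, rfl⟩
  have hl : (X (Fin.last n) ^ 2 : MvPolynomial (Fin (n + 1)) ℚ) ∈ qtrivIdealQ n :=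
    Ideal.subset_span ⟨Fin.last n, by simp⟩
  have hC : (2 * C (-(1 / 2)) : MvPolynomial (Fin (n + 1)) ℚ) = -1 := by
    rw [← map_ofNat C 2, ← C_mul, ← C_1, ← C_neg]
    norm_num
  simp only [SetLike.mem_coe, Ideal.mem_comap, map_pow, shearHom_X]
  by_cases hi : i = Fin.last n
  · simpa [hi] using hl
  · have h1 : (X i ^ 2 - X i * X (Fin.last n) : MvPolynomial (Fin (n + 1)) ℚ) ∈ qtrivIdealQ n :=
      Ideal.subset_span ⟨i, by simp [hi]⟩
    rw [if_neg hi]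
    convert Ideal.add_mem _ h1 (Ideal.mul_mem_left _ (C (-(1 / 2)) ^ 2) hl) using 1
    linear_combination X i * X (Fin.last n) * hC

theorem shear_qtriv_le (n : ℕ) :
    qtrivIdealQ n ≤ (prodIdealQ n).comap (shearHom n (1 / 2)) := by
  unfold qtrivIdealQ
  rw [Ideal.span_le]
  rintro _ ⟨i, rfl⟩
  have hX : ∀ j, (X j ^ 2 : MvPolynomial (Fin (n + 1)) ℚ) ∈ prodIdealQ n :=
    fun j => Ideal.subset_span ⟨j, rfl⟩
  have hC : (2 * C (1 / 2) : MvPolynomial (Fin (n + 1)) ℚ) = 1 := by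
    rw [← map_ofNat C 2, ← C_mul, ← C_1]
    norm_num
  simp only [SetLike.mem_coe, Ideal.mem_comap]
  by_cases hi : i = Fin.last n
  · simpa [hi, shearHom_X] using hX (Fin.last n)
  · simp only [if_neg hi, map_sub, map_mul, map_pow, shearHom_X, if_true]
    convert Ideal.add_mem _ (hX i)
      (Ideal.mul_mem_left _ (C (1 / 2) ^ 2 - C (1 / 2)) (hX (Fin.last n))) using 1
    linear_combination X i * X (Fin.last n) * hC

/-- The `ℚ`-algebra homomorphism determined by `y_i ↦ x_i − (1/2)x_last` for `i ≠ last` and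
`y_last ↦ x_last` descends to a `ℚ`-algebra isomorphism
`ℚ[y]/⟨y_i²⟩ ≅ ℚ[x]/⟨x_i² − x_i x_last, x_last²⟩`; i.e. the Bott manifold `ℋ(λ₁,…,λ_{n+1})`
is `ℚ`-trivial. -/
theorem stmt_6 (n : ℕ) :
    ∃ e : (MvPolynomial (Fin (n + 1)) ℚ ⧸ prodIdealQ n) ≃ₐ[ℚ]
        (MvPolynomial (Fin (n + 1)) ℚ ⧸ qtrivIdealQ n),
      ∀ i : Fin (n + 1), e (Ideal.Quotient.mk (prodIdealQ n) (X i)) =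
        Ideal.Quotient.mk (qtrivIdealQ n)
          (if i = Fin.last n then X (Fin.last n)
           else X i - C (1 / 2 : ℚ) * X (Fin.last n)) := by
  refine ⟨AlgEquiv.ofAlgHom
    (Ideal.quotientMapₐ (qtrivIdealQ n) (shearHom n (-(1 / 2))) (shear_prod_le n))
    (Ideal.quotientMapₐ (prodIdealQ n) (shearHom n (1 / 2)) (shear_qtriv_le n)) ?_ ?_, ?_⟩
  · apply Ideal.Quotient.algHom_ext
    ext i : 1
    change Ideal.Quotient.mk _ (shearHom n (-(1 / 2)) (shearHom n (1 / 2) (X i))) = 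
      Ideal.Quotient.mk _ (X i)
    rw [shearHom_comp _ _ _ (by norm_num)]
  · apply Ideal.Quotient.algHom_ext
    ext i : 1
    change Ideal.Quotient.mk _ (shearHom n (1 / 2) (shearHom n (-(1 / 2)) (X i))) = 
      Ideal.Quotient.mk _ (X i)
    rw [shearHom_comp _ _ _ (by norm_num)]
  · intro i
    change Ideal.Quotient.mk _ (shearHom n (-(1 / 2)) (X i)) = _
    rw [shearHom_X, C_neg, neg_mul, ← sub_eq_add_neg]
end

section
/- Let n ≥ 1 and let R = ℤ[x₁,…,x_n]/⟨x₁² − x₁x_n, …, x_{n−1}² − x_{n−1}x_n, x_n²⟩. Let c = (c₁,…,c_n) ∈ ℤⁿ with gcd(c₁,…,c_n) = 1. Then (c₁x₁ + ⋯ + c_nx_n)² = 0 in R if and only if c = e_n, or c = −e_n, or there exists i < n with c = 2e_i − e_n or c = −(2e_i − e_n); equivalently, the primitive elements of the ℤ-span of x₁,…,x_n whose square vanishes are exactly ±x_n and ±(2x_i − x_n) for i < n, giving exactly 2n such elements. -/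
open MvPolynomial

/-- The presentation ideal of the integral cohomology of the standard `ℚ`-trivial Bott
manifold `ℋ(λ₁,…,λ_{n+1})`: `⟨x_i² − x_i·x_last (i ≠ last), x_last²⟩` in `n+1` variables. -/
noncomputable def qtrivIdealZ (n : ℕ) : Ideal (MvPolynomial (Fin (n + 1)) ℤ) :=
  Ideal.span (Set.range fun i : Fin (n + 1) =>
    if i = Fin.last n then X (Fin.last n) ^ 2 else X i ^ 2 - X i * X (Fin.last n))

lemma exists_test_ring : ∃ (S : Type) (_ : CommRing S) (a b : S), a ^ 2 = 0 ∧ b ^ 2 = 0 ∧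
    ∀ k : ℤ, (k : S) * (a * b) = 0 → k = 0 := by
  refine ⟨DualNumber (DualNumber ℤ), inferInstance, TrivSqZeroExt.inl DualNumber.eps,
    DualNumber.eps, ?_, ?_, ?_⟩
  · rw [pow_two, ← TrivSqZeroExt.inl_mul, DualNumber.eps_mul_eps, TrivSqZeroExt.inl_zero]
  · rw [pow_two, DualNumber.eps_mul_eps]
  · intro k hk
    have h1 := congrArg TrivSqZeroExt.snd (congrArg TrivSqZeroExt.snd hk)
    have e : ((k : DualNumber (DualNumber ℤ))) = TrivSqZeroExt.inl (TrivSqZeroExt.inl k) := by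
      rfl
    rw [e] at h1
    simp only [DualNumber.eps, TrivSqZeroExt.snd_mul, TrivSqZeroExt.fst_inl,
      TrivSqZeroExt.snd_inl, TrivSqZeroExt.fst_inr, TrivSqZeroExt.snd_inr, smul_eq_mul,
      TrivSqZeroExt.fst_mul, TrivSqZeroExt.snd_add, TrivSqZeroExt.snd_zero] at h1
    simpa using h1

/-- Pushing a square-zero relation forward to any ring in which the relations hold. -/
lemma push_rel {S : Type} [CommRing S] (n : ℕ) (c : Fin (n + 1) → ℤ) (y : Fin (n + 1) → S)
    (hl : y (Fin.last n) ^ 2 = 0)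
    (hy : ∀ i, i ≠ Fin.last n → y i ^ 2 = y i * y (Fin.last n))
    (h : (Ideal.Quotient.mk (qtrivIdealZ n) (∑ i, C (c i) * X i)) ^ 2 = 0) :
    (∑ i, (c i : S) * y i) ^ 2 = 0 := by
  rw [← map_pow, Ideal.Quotient.eq_zero_iff_mem] at h
  have hle : qtrivIdealZ n ≤ RingHom.ker (eval₂Hom (Int.castRingHom S) y) := by
    unfold qtrivIdealZ
    rw [Ideal.span_le]
    rintro _ ⟨i, rfl⟩
    simp only [SetLike.mem_coe, RingHom.mem_ker]
    split_ifs with hi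
    · simpa using hl
    · simp [hy i hi]
  have := hle h
  rw [RingHom.mem_ker] at this
  simpa only [map_pow, map_sum, map_mul, coe_eval₂Hom, eval₂_C, eval₂_X,
    eq_intCast (Int.castRingHom S)] using this

lemma coeffs_pair (n : ℕ) (c : Fin (n + 1) → ℤ)
    (h : (Ideal.Quotient.mk (qtrivIdealZ n) (∑ i, C (c i) * X i)) ^ 2 = 0)
    (i j : Fin (n + 1)) (hi : i ≠ Fin.last n) (hj : j ≠ Fin.last n) (hij : i ≠ j) :
    c i * c j = 0 := by
  obtain ⟨S, _, a, b, ha, hb, hab⟩ := exists_test_ring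
  have := push_rel n c (fun k => (if k = i then a else 0) + (if k = j then b else 0))
    (by simp [hi.symm, hj.symm])
    (by
      intro k hk
      simp only [hi.symm, hj.symm, if_false, add_zero, mul_zero]
      by_cases h1 : k = i
      · subst h1; simp [hij, ha]
      · by_cases h2 : k = j
        · subst h2; simp [h1, hb]
        · simp [h1, h2]) h
  simp only [mul_add, Finset.sum_add_distrib, mul_ite, mul_zero, Finset.sum_ite_eq',
    Finset.mem_univ, if_true] at this
  have h2 := hab (2 * (c i * c j)) (by
    push_cast
    linear_combination this - (c i : S) ^ 2 * ha - (c j : S) ^ 2 * hb)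
  lia

lemma coeffs_single (n : ℕ) (c : Fin (n + 1) → ℤ)
    (h : (Ideal.Quotient.mk (qtrivIdealZ n) (∑ i, C (c i) * X i)) ^ 2 = 0)
    (i : Fin (n + 1)) (hi : i ≠ Fin.last n) :
    c i = 0 ∨ c i = -2 * c (Fin.last n) := by
  obtain ⟨S, _, a, b, ha, hb, hab⟩ := exists_test_ring
  have := push_rel n c
    (fun k => (if k = i then a + b else 0) + (if k = Fin.last n then 2 * a else 0))
    (by simp [hi.symm, mul_pow, ha])
    (by
      intro k hk
      by_cases h1 : k = i
      · subst h1
        simp only [hi, hi.symm, if_true, if_false]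
        linear_combination hb - ha
      · simp [h1, hk]) h
  simp only [mul_add, Finset.sum_add_distrib, mul_ite, mul_zero, Finset.sum_ite_eq',
    Finset.mem_univ, if_true] at this
  have h2 := hab (2 * (c i * (c i + 2 * c (Fin.last n)))) (by
    push_cast
    linear_combination this - ((c i : S) + 2 * c (Fin.last n)) ^ 2 * ha - (c i : S) ^ 2 * hb)
  rcases mul_eq_zero.1 ((mul_eq_zero.1 h2).resolve_left (by norm_num)) with h3 | h3
  · exact Or.inl h3
  · right; lia

/-- The candidate vectors. -/
def cand (n : ℕ) (i : Fin (n + 1)) : Fin (n + 1) → ℤ :=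
  if i = Fin.last n then Pi.single (Fin.last n) 1
  else 2 • Pi.single i 1 - Pi.single (Fin.last n) 1

lemma rel_last (n : ℕ) : Ideal.Quotient.mk (qtrivIdealZ n) (X (Fin.last n)) ^ 2 = 0 := by
  rw [← map_pow, Ideal.Quotient.eq_zero_iff_mem]
  exact Ideal.subset_span ⟨Fin.last n, by simp⟩

lemma rel_ne (n : ℕ) (i : Fin (n + 1)) (hi : i ≠ Fin.last n) :
    Ideal.Quotient.mk (qtrivIdealZ n) (X i) ^ 2 - Ideal.Quotient.mk (qtrivIdealZ n) (X i) *
      Ideal.Quotient.mk (qtrivIdealZ n) (X (Fin.last n)) = 0 := by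
  rw [← map_pow, ← map_mul, ← map_sub, Ideal.Quotient.eq_zero_iff_mem]
  exact Ideal.subset_span ⟨i, by simp [hi]⟩

lemma cand_sq (n : ℕ) (i : Fin (n + 1)) :
    (Ideal.Quotient.mk (qtrivIdealZ n) (∑ j, C (cand n i j) * X j)) ^ 2 = 0 := by
  unfold cand
  split_ifs with hi
  · have : (∑ j, C ((Pi.single (Fin.last n) 1 : Fin (n + 1) → ℤ) j) * X j :
        MvPolynomial (Fin (n + 1)) ℤ) = X (Fin.last n) := by
      simp [Pi.single_apply, apply_ite C, ite_mul]
    rw [this, rel_last]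
  · have : (∑ j, C ((2 • Pi.single i 1 - Pi.single (Fin.last n) 1 : Fin (n + 1) → ℤ) j) * X j :
        MvPolynomial (Fin (n + 1)) ℤ) = 2 * X i - X (Fin.last n) := by
      simp [Pi.single_apply, apply_ite C, ite_mul, mul_ite, sub_mul, Finset.sum_sub_distrib]
    rw [this, map_sub, map_mul, map_ofNat]
    linear_combination 4 * rel_ne n i hi + rel_last n

lemma neg_sq_iff (n : ℕ) (c : Fin (n + 1) → ℤ) :
    (Ideal.Quotient.mk (qtrivIdealZ n) (∑ j, C ((-c) j) * X j)) ^ 2 =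
    (Ideal.Quotient.mk (qtrivIdealZ n) (∑ j, C (c j) * X j)) ^ 2 := by
  have : (∑ j, C ((-c) j) * X j : MvPolynomial (Fin (n + 1)) ℤ) = -∑ j, C (c j) * X j := by
    simp
  rw [this, map_neg]
  ring

lemma main_iff (n : ℕ) (c : Fin (n + 1) → ℤ) (hc : Finset.univ.gcd c = 1) :
    (Ideal.Quotient.mk (qtrivIdealZ n) (∑ i, C (c i) * X i)) ^ 2 = 0 ↔
      ∃ i, c = cand n i ∨ c = -cand n i := by
  constructor
  · intro h
    have hdvd : c (Fin.last n) ∣ 1 := by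
      rw [← hc]
      refine Finset.dvd_gcd fun i _ => ?_
      by_cases hi : i = Fin.last n
      · rw [hi]
      · rcases coeffs_single n c h i hi with h1 | h1
        · simp [h1]
        · rw [h1]; exact Dvd.intro_left _ rfl
    have hu := Int.isUnit_iff.1 (isUnit_of_dvd_one hdvd)
    by_cases hz : ∃ i, i ≠ Fin.last n ∧ c i ≠ 0
    · obtain ⟨i, hi, hci⟩ := hz
      have h1 := (coeffs_single n c h i hi).resolve_left hci
      have h2 : ∀ j, j ≠ Fin.last n → j ≠ i → c j = 0 := fun j hj hji =>
        (mul_eq_zero.1 (coeffs_pair n c h i j hi hj hji.symm)).resolve_left hci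
      refine ⟨i, ?_⟩
      simp only [cand, hi, if_false]
      rcases hu with hu | hu
      · right
        ext j
        by_cases hj : j = Fin.last n
        · subst hj; simp [hu, Pi.single_apply, hi.symm]
        · by_cases hji : j = i
          · subst hji; simp [h1, hu, Pi.single_apply, hj]
          · simp [h2 j hj hji, hj, hji]
      · left
        ext j
        by_cases hj : j = Fin.last n
        · subst hj; simp [hu, Pi.single_apply, hi.symm]
        · by_cases hji : j = i
          · subst hji; simp [h1, hu, Pi.single_apply, hj]
          · simp [h2 j hj hji, hj, hji]
    · push Not at hz
      refine ⟨Fin.last n, ?_⟩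
      simp only [cand, if_true]
      refine hu.imp (fun hu => ?_) (fun hu => ?_) <;>
      · ext j
        by_cases hj : j = Fin.last n
        · subst hj; simp [hu]
        · simp [hz j hj, hj]
  · rintro ⟨i, rfl | rfl⟩
    · exact cand_sq n i
    · rw [neg_sq_iff]; exact cand_sq n i

lemma gcd_of_last (n : ℕ) (c : Fin (n + 1) → ℤ) (h : c (Fin.last n) = 1 ∨ c (Fin.last n) = -1) :
    Finset.univ.gcd c = 1 := by
  have hd : Finset.univ.gcd c ∣ c (Fin.last n) := Finset.gcd_dvd (Finset.mem_univ _)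
  have hu : IsUnit (Finset.univ.gcd c) := isUnit_of_dvd_unit hd (Int.isUnit_iff.2 h)
  rw [← Finset.normalize_gcd]
  exact normalize_eq_one.2 hu

lemma cand_last (n : ℕ) (i : Fin (n + 1)) :
    cand n i (Fin.last n) = if i = Fin.last n then 1 else -1 := by
  unfold cand
  split_ifs with hi
  · simp
  · simp [Ne.symm hi]

lemma cand_self (n : ℕ) (i j : Fin (n + 1)) (hj : j ≠ Fin.last n) :
    cand n i j = if i = j then 2 else 0 := by
  unfold cand
  by_cases hi : i = Fin.last n
  · subst hi; simp [hj, hj.symm]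
  · by_cases hij : i = j
    · subst hij; simp [hi]
    · simp [hi, hij, hj, Ne.symm hij]

/-- All signed candidate vectors. -/
def scand (n : ℕ) (p : Fin (n + 1) × Bool) : Fin (n + 1) → ℤ :=
  if p.2 then cand n p.1 else -cand n p.1

lemma scand_inj (n : ℕ) : Function.Injective (scand n) := by
  rintro ⟨i, s⟩ ⟨j, t⟩ h
  have hl := congrFun h (Fin.last n)
  have hi := congrFun h i
  have hj := congrFun h j
  have key : i = j := by
    by_contra hij
    by_cases h1 : i = Fin.last n
    · have h2 : j ≠ Fin.last n := fun e => hij (h1.trans e.symm)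
      cases s <;> cases t <;> simp [scand, cand_self n _ j h2, hij] at hj
    · cases s <;> cases t <;> simp [scand, cand_self n _ i h1, Ne.symm hij] at hi
  subst key
  cases s <;> cases t
  · rfl
  · exfalso
    simp only [scand, Pi.neg_apply, cand_last, if_true, Bool.false_eq_true, if_false] at hl
    split_ifs at hl <;> norm_num at hl
  · exfalso
    simp only [scand, Pi.neg_apply, cand_last, if_true, Bool.false_eq_true, if_false] at hl
    split_ifs at hl <;> norm_num at hl
  · rfl

/-- In `R = ℤ[x₁,…,x_n]/⟨x_i² − x_i x_n (i<n), x_n²⟩` (here with `n+1` variables), a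
primitive element `Σ c_i x_i` squares to zero iff `c = ±e_last` or `c = ±(2e_i − e_last)`
for some `i ≠ last`; there are exactly `2(n+1)` such primitive square-zero elements. -/
theorem stmt_7 (n : ℕ) :
    (∀ c : Fin (n + 1) → ℤ, Finset.univ.gcd c = 1 →
      ((Ideal.Quotient.mk (qtrivIdealZ n) (∑ i, C (c i) * X i)) ^ 2 = 0 ↔
        c = Pi.single (Fin.last n) 1 ∨ c = -Pi.single (Fin.last n) 1 ∨
          ∃ i : Fin (n + 1), i ≠ Fin.last n ∧
            (c = 2 • Pi.single i 1 - Pi.single (Fin.last n) 1 ∨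
             c = -(2 • Pi.single i 1 - Pi.single (Fin.last n) 1)))) ∧
    Set.ncard {c : Fin (n + 1) → ℤ | Finset.univ.gcd c = 1 ∧
        (Ideal.Quotient.mk (qtrivIdealZ n) (∑ i, C (c i) * X i)) ^ 2 = 0} =
      2 * (n + 1) := by
  refine ⟨fun c hc => ?_, ?_⟩
  · rw [main_iff n c hc]
    constructor
    · rintro ⟨i, hi⟩
      by_cases h : i = Fin.last n
      · simp only [cand, h, if_true] at hi
        exact hi.elim Or.inl (fun h => Or.inr (Or.inl h))
      · simp only [cand, h, if_false] at hi
        exact Or.inr (Or.inr ⟨i, h, hi⟩)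
    · rintro (h | h | ⟨i, hi, h⟩)
      · exact ⟨Fin.last n, by simp only [cand, if_true]; exact Or.inl h⟩
      · exact ⟨Fin.last n, by simp only [cand, if_true]; exact Or.inr h⟩
      · exact ⟨i, by simp only [cand, hi, if_false]; exact h⟩
  · have : {c : Fin (n + 1) → ℤ | Finset.univ.gcd c = 1 ∧
        (Ideal.Quotient.mk (qtrivIdealZ n) (∑ i, C (c i) * X i)) ^ 2 = 0} =
        Set.range (scand n) := by
      ext c
      simp only [Set.mem_setOf_eq, Set.mem_range]
      constructor
      · rintro ⟨hc, h⟩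
        obtain ⟨i, h | h⟩ := (main_iff n c hc).1 h
        · exact ⟨(i, true), by simp [scand, h]⟩
        · exact ⟨(i, false), by simp [scand, h]⟩
      · rintro ⟨⟨i, s⟩, rfl⟩
        have hg : Finset.univ.gcd (scand n (i, s)) = 1 := by
          apply gcd_of_last
          cases s <;> simp only [scand, Pi.neg_apply, cand_last, if_true] <;>
            by_cases h : i = Fin.last n <;> simp [h, cand_last]
        refine ⟨hg, (main_iff n _ hg).2 ⟨i, ?_⟩⟩
        cases s <;> simp [scand]
    rw [this, ← Set.image_univ, Set.ncard_image_of_injective _ (scand_inj n), Set.ncard_univ]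
    simp [mul_comm]
end

section
/- Let n ≥ 1 and let R = ℤ[x₁,…,x_n]/⟨x₁² − x₁x_n, …, x_{n−1}² − x_{n−1}x_n, x_n²⟩. If c = (c₁,…,c_n) ∈ ℤⁿ satisfies gcd(c₁,…,c_n) = 1 and (c₁x₁ + ⋯ + c_nx_n)² = 0 in R, then c₁x₁ + ⋯ + c_nx_n ≡ x_n modulo 2R, i.e., there exists r ∈ R with c₁x₁ + ⋯ + c_nx_n − x_n = 2r. In particular, any two primitive elements of the span of x₁,…,x_n whose squares vanish are congruent modulo 2. -/
open MvPolynomial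

/-- Each non-last coefficient satisfies `c_i (c_i + 2 c_last) = 0`: map `x_i`, `x_last` to
`t + ε/2`, `ε` in `ℚ[ε][t]` and every other variable to `0`. -/
theorem coeff_eq (n : ℕ) (c : Fin (n + 1) → ℤ)
    (hsq : (Ideal.Quotient.mk (qtrivIdealZ n) (∑ i, C (c i) * X i)) ^ 2 = 0)
    (i : Fin (n + 1)) (hi : i ≠ Fin.last n) : c i * (c i + 2 * c (Fin.last n)) = 0 := by
  let b : DualNumber (DualNumber ℚ) := TrivSqZeroExt.inl (TrivSqZeroExt.inr 1)
  let a : DualNumber (DualNumber ℚ) :=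
    TrivSqZeroExt.inl (TrivSqZeroExt.inr (1 / 2)) + TrivSqZeroExt.inr 1
  have hb : b ^ 2 = 0 := by
    rw [pow_two]
    ext <;> simp [b]
  have ha : a ^ 2 = a * b := by
    rw [pow_two]
    ext <;> simp [a, b]
    norm_num
  let v : Fin (n + 1) → DualNumber (DualNumber ℚ) :=
    fun j => if j = Fin.last n then b else if j = i then a else 0
  let f := eval₂Hom (Int.castRingHom (DualNumber (DualNumber ℚ))) v
  have hX : ∀ j, f (X j) = v j := fun j => by simp [f]
  have hf : qtrivIdealZ n ≤ RingHom.ker f := by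
    rw [qtrivIdealZ, Ideal.span_le]
    rintro _ ⟨j, rfl⟩
    simp only [SetLike.mem_coe, RingHom.mem_ker]
    by_cases hj : j = Fin.last n
    · simp [hj, hX, v, hb]
    · by_cases hji : j = i
      · simp [hji, hi, hX, v, ha]
      · simp [hj, hji, hX, v]
  rw [← map_pow, Ideal.Quotient.eq_zero_iff_mem] at hsq
  have h0 : f ((∑ i, C (c i) * X i) ^ 2) = 0 := hf hsq
  have hs : f (∑ i, C (c i) * X i) = (c (Fin.last n) : DualNumber (DualNumber ℚ)) * b + c i * a := by
    have hv : ∀ j, v j = (if j = Fin.last n then b else 0) + (if j = i then a else 0) := by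
      intro j
      by_cases hj : j = Fin.last n
      · simp [v, hj, hi.symm]
      · simp [v, hj]
    simp only [map_sum, map_mul, f, coe_eval₂Hom, eval₂_C, eval₂_X, hv, mul_add,
      Finset.sum_add_distrib]
    simp
  rw [map_pow, hs, pow_two] at h0
  have h1 := congrArg (fun z => TrivSqZeroExt.snd (TrivSqZeroExt.snd z)) h0
  simp [a, b] at h1
  have h2 : (c i : ℚ) * (c i + 2 * c (Fin.last n)) = 0 := by
    linarith
  exact_mod_cast h2

theorem stmt_8 (n : ℕ) (c : Fin (n + 1) → ℤ) (hprim : Finset.univ.gcd c = 1)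
    (hsq : (Ideal.Quotient.mk (qtrivIdealZ n) (∑ i, C (c i) * X i)) ^ 2 = 0) :
    ∃ r : MvPolynomial (Fin (n + 1)) ℤ ⧸ qtrivIdealZ n,
      Ideal.Quotient.mk (qtrivIdealZ n) (∑ i, C (c i) * X i) -
        Ideal.Quotient.mk (qtrivIdealZ n) (X (Fin.last n)) = 2 * r := by
  have hev : ∀ i, i ≠ Fin.last n → (2 : ℤ) ∣ c i := by
    intro i hi
    rcases mul_eq_zero.mp (coeff_eq n c hsq i hi) with h | h
    · simp [h]
    · omega
  have hodd : ¬ (2 : ℤ) ∣ c (Fin.last n) := by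
    intro h
    have h2 : (2 : ℤ) ∣ Finset.univ.gcd c := by
      apply Finset.dvd_gcd
      intro i _
      by_cases hi : i = Fin.last n
      · rw [hi]; exact h
      · exact hev i hi
    rw [hprim] at h2
    omega
  have hd : ∀ i, ∃ d : ℤ, c i = 2 * d + if i = Fin.last n then 1 else 0 := by
    intro i
    by_cases hi : i = Fin.last n
    · subst hi
      exact ⟨c (Fin.last n) / 2, by simp; omega⟩
    · obtain ⟨d, h⟩ := hev i hi
      exact ⟨d, by simp [hi, h]⟩
  choose d hd using hd
  refine ⟨Ideal.Quotient.mk (qtrivIdealZ n) (∑ i, C (d i) * X i), ?_⟩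
  have key : (∑ i, C (c i) * X i : MvPolynomial (Fin (n + 1)) ℤ)
      = 2 * (∑ i, C (d i) * X i) + X (Fin.last n) := by
    have : ∀ i, (C (c i) * X i : MvPolynomial (Fin (n + 1)) ℤ)
        = 2 * (C (d i) * X i) + if i = Fin.last n then X i else 0 := by
      intro i
      rw [hd i]
      have h2 : (C (2 : ℤ) : MvPolynomial (Fin (n + 1)) ℤ) = 2 := map_ofNat C 2
      by_cases hi : i = Fin.last n
      · simp only [hi, if_true, C_add, C_mul, C_1, h2]; ring
      · simp only [hi, if_false, C_add, C_mul, C_0, h2]; ring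
    rw [Finset.sum_congr rfl fun i _ => this i, Finset.sum_add_distrib, ← Finset.mul_sum]
    simp
  rw [key, map_add, map_mul, map_ofNat]
  ring
end

section
/- Let n ≥ 1 and let S be a finitely generated submonoid of ℕ × ℤⁿ such that S ∩ ({0} × ℤⁿ) = {(0,0)}. Then the Okounkov body Δ(S), defined as the closure of the convex hull in ℝⁿ of the set { (1/m)·x : (m,x) ∈ S, m > 0 }, is a rational convex polytope: there exists a finite set V ⊆ ℚⁿ with Δ(S) = conv(V). -/
/-- If `S` is a finitely generated submonoid of `ℕ × ℤⁿ` with `S ∩ ({0} × ℤⁿ) = {(0,0)}`,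
then the Okounkov body `Δ(S) = closure(conv{x/m : (m,x) ∈ S, m > 0})` is a rational
convex polytope: the convex hull of a finite set of rational points. -/
theorem stmt_9 (n : ℕ) (hn : 1 ≤ n) (S : AddSubmonoid (ℕ × (Fin n → ℤ)))
    (hfg : S.FG) (h0 : ∀ x : Fin n → ℤ, (0, x) ∈ S → x = 0) :
    ∃ V : Finset (Fin n → ℚ),
      closure (convexHull ℝ {y : Fin n → ℝ | ∃ m : ℕ, 0 < m ∧ ∃ x : Fin n → ℤ,
          (m, x) ∈ S ∧ y = (m : ℝ)⁻¹ • fun i => (x i : ℝ)}) =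
        convexHull ℝ ((fun q : Fin n → ℚ => fun i => ((q i : ℝ))) '' ↑V) := by
  classical
  obtain ⟨T, hT⟩ := hfg
  let f : ℕ × (Fin n → ℤ) → (Fin n → ℚ) := fun t i => (t.1 : ℚ)⁻¹ * (t.2 i : ℚ)
  let W : Finset (Fin n → ℚ) := (T.filter (fun t => 0 < t.1)).image f
  refine ⟨W, ?_⟩
  set V : Set (Fin n → ℝ) := (fun q : Fin n → ℚ => fun i => ((q i : ℝ))) '' (W : Set (Fin n → ℚ))
    with hV
  have hTS : ∀ t ∈ T, t ∈ S := fun t ht => hT ▸ AddSubmonoid.subset_closure ht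
  have key : ∀ s ∈ S, s = 0 ∨ (0 < s.1 ∧
      ((s.1 : ℝ)⁻¹ • fun i => (s.2 i : ℝ)) ∈ convexHull ℝ V) := by
    intro s hs
    rw [← hT] at hs
    induction hs using AddSubmonoid.closure_induction with
    | mem t ht =>
      rcases Nat.eq_zero_or_pos t.1 with h | h
      · left
        obtain ⟨m, x⟩ := t
        simp only at h
        subst h
        rw [h0 x (hTS _ ht)]
        rfl
      · right
        refine ⟨h, subset_convexHull ℝ V ?_⟩
        refine ⟨f t, ?_, ?_⟩
        · exact Finset.mem_coe.2 (Finset.mem_image_of_mem f (Finset.mem_filter.2 ⟨ht, h⟩))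
        · ext i
          simp [f]
    | zero => exact Or.inl rfl
    | add a b _ _ ha hb =>
      rcases ha with rfl | ⟨ha, ha'⟩
      · simpa using hb
      rcases hb with rfl | ⟨hb, hb'⟩
      · right
        simpa using And.intro ha ha'
      right
      refine ⟨by simp only [Prod.fst_add]; omega, ?_⟩
      have h1 : (0 : ℝ) < a.1 := by exact_mod_cast ha
      have h2 : (0 : ℝ) < b.1 := by exact_mod_cast hb
      have := convex_convexHull ℝ V ha' hb' (a := a.1 / (a.1 + b.1)) (b := b.1 / (a.1 + b.1))
        (by positivity) (by positivity) (by field_simp)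
      convert this using 1
      ext i
      simp only [Prod.fst_add, Prod.snd_add, Pi.add_apply, Pi.smul_apply, smul_eq_mul]
      push_cast
      field_simp
  have hVfin : V.Finite := W.finite_toSet.image _
  have hcl : IsClosed (convexHull ℝ V) := hVfin.isClosed_convexHull ℝ
  apply subset_antisymm
  · apply closure_minimal _ hcl
    apply convexHull_min _ (convex_convexHull ℝ V)
    rintro y ⟨m, hm, x, hx, rfl⟩
    rcases key _ hx with h | h
    · have : m = 0 := congrArg Prod.fst h
      omega
    · exact h.2
  · refine subset_trans (convexHull_mono ?_) subset_closure
    rintro _ ⟨q, hq, rfl⟩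
    obtain ⟨t, ht, rfl⟩ := Finset.mem_image.1 (Finset.mem_coe.1 hq)
    obtain ⟨ht, hp⟩ := Finset.mem_filter.1 ht
    refine ⟨t.1, hp, t.2, hTS t ht, ?_⟩
    ext i
    simp [f]
end

section
/- Let n ≥ 1 and let S be a submonoid of ℕ × ℤⁿ containing an element of the form (1, x₀). For each integer m > 0 set A_m := { x ∈ ℤⁿ : (m,x) ∈ S }. Then the closure of the convex hull of { (1/m)·x : (m,x) ∈ S, m > 0 } equals the closure of ⋃_{m>0} (1/m)·conv(A_m); that is, the Okounkov body Δ(S) equals the closure of the union of the rescaled convex hulls Δ_m := (1/m)·conv(A_m). -/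
open scoped Pointwise

/-- For a submonoid `S ⊆ ℕ × ℤⁿ` containing some `(1, x₀)`, the Okounkov body
`Δ(S) = closure(conv{x/m : (m,x) ∈ S, m > 0})` equals the closure of the union of the
rescaled convex hulls `Δ_m = (1/m)·conv(A_m)`, where `A_m = {x : (m,x) ∈ S}`. -/
theorem stmt_10 (n : ℕ) (hn : 1 ≤ n) (S : AddSubmonoid (ℕ × (Fin n → ℤ)))
    (x₀ : Fin n → ℤ) (hx₀ : (1, x₀) ∈ S) :
    closure (convexHull ℝ {y : Fin n → ℝ | ∃ m : ℕ, 0 < m ∧ ∃ x : Fin n → ℤ,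
        (m, x) ∈ S ∧ y = (m : ℝ)⁻¹ • fun i => (x i : ℝ)}) =
      closure (⋃ m ∈ {m : ℕ | 0 < m},
        (m : ℝ)⁻¹ • convexHull ℝ
          ((fun x : Fin n → ℤ => fun i => (x i : ℝ)) '' {x | (m, x) ∈ S})) := by
  have mono : ∀ m k : ℕ, 0 < m → 0 < k →
      (m : ℝ)⁻¹ • convexHull ℝ
          ((fun x : Fin n → ℤ => fun i => (x i : ℝ)) '' {x | (m, x) ∈ S}) ⊆
      ((k * m : ℕ) : ℝ)⁻¹ • convexHull ℝ
          ((fun x : Fin n → ℤ => fun i => (x i : ℝ)) '' {x | (k * m, x) ∈ S}) := by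
    intro m k hm hk
    rw [← convexHull_smul, ← convexHull_smul]
    apply convexHull_mono
    rintro _ ⟨_, ⟨x, hx, rfl⟩, rfl⟩
    refine ⟨_, ⟨k • x, ?_, rfl⟩, ?_⟩
    · have h := S.nsmul_mem hx k
      simpa using h
    · have hm' : (m : ℝ) ≠ 0 := by positivity
      have hk' : (k : ℝ) ≠ 0 := by positivity
      ext i
      simp
      field_simp
  congr 1
  apply Set.Subset.antisymm
  · apply convexHull_min
    · rintro _ ⟨m, hm, x, hx, rfl⟩
      refine Set.mem_biUnion (x := m) hm ?_
      exact Set.smul_mem_smul_set (subset_convexHull ℝ _ ⟨x, hx, rfl⟩)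
    · intro a ha b hb s t hs ht hst
      simp only [Set.mem_iUnion, Set.mem_setOf_eq, exists_prop] at ha hb
      obtain ⟨m, hm, ha⟩ := ha
      obtain ⟨k, hk, hb⟩ := hb
      have ha' := mono m k hm hk ha
      have hb' := mono k m hk hm hb
      rw [mul_comm m k] at hb'
      refine Set.mem_biUnion (x := k * m) (Nat.mul_pos hk hm) ?_
      exact ((convex_convexHull ℝ _).smul _) ha' hb' hs ht hst
  · refine Set.iUnion₂_subset fun m hm => ?_
    rw [← convexHull_smul]
    apply convexHull_mono
    rintro _ ⟨_, ⟨x, hx, rfl⟩, rfl⟩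
    exact ⟨m, hm, x, hx, rfl⟩
end

section
/- Let n ≥ 2, let A = (A^i_j) be an n×n integer matrix with A^i_j = 0 unless i < j (strictly upper-triangular), and suppose there exist indices 1 ≤ k < ℓ ≤ n and an integer m such that A^k_ℓ = −2m and A^k_j = −m·A^ℓ_j for all j ≠ ℓ (i.e., the class x_k is of even exceptional type, with α_k = 2m·y_ℓ). Define the strictly upper-triangular integer matrix Ã by: Ã^i_j = A^i_j for all i and all j ≠ ℓ; Ã^k_ℓ = 0; and Ã^i_ℓ = A^i_ℓ + m·A^i_k for all i ≠ k. Then the ring homomorphism from ℤ[x₁,…,x_n] to ℤ[x₁,…,x_n]/⟨x_i² + Σ_j Ã^i_j x_j x_i : 1 ≤ i ≤ n⟩ determined by x_k ↦ x_k + m·x_ℓ and x_i ↦ x_i for i ≠ k descends to a ring isomorphism ℤ[x₁,…,x_n]/⟨x_i² + Σ_j A^i_j x_j x_i : 1 ≤ i ≤ n⟩ ≅ ℤ[x₁,…,x_n]/⟨x_i² + Σ_j Ã^i_j x_j x_i : 1 ≤ i ≤ n⟩. -/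
open MvPolynomial

/-- The presentation ideal of the integral cohomology of the Bott manifold `M_A`
associated to a strictly upper-triangular integer matrix `A` (Danilov):
`⟨x_i² + Σ_j A^i_j x_j x_i : i⟩ ⊆ ℤ[x₁,…,x_n]`. -/
noncomputable def bottIdeal {n : ℕ} (A : Matrix (Fin n) (Fin n) ℤ) :
    Ideal (MvPolynomial (Fin n) ℤ) :=
  Ideal.span (Set.range fun i : Fin n => X i ^ 2 + ∑ j, C (A i j) * X j * X i)

theorem bott_sum_update {n : ℕ} (B B' : Fin n → ℤ) (l : Fin n) (c : ℤ)
    (h : ∀ j, j ≠ l → B' j = B j) (hl : B' l = B l + c) :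
    (∑ j, C (B' j) * X j : MvPolynomial (Fin n) ℤ) = ∑ j, C (B j) * X j + C c * X l := by
  have : ∀ j, (C (B' j) * X j : MvPolynomial (Fin n) ℤ)
      = C (B j) * X j + (if j = l then C c * X l else 0) := by
    intro j
    split_ifs with hj
    · subst hj
      rw [hl, C_add]; ring
    · rw [h j hj, add_zero]
  simp only [this, Finset.sum_add_distrib, Finset.sum_ite_eq', Finset.sum_ite_eq, Finset.mem_univ, if_true]

noncomputable def bottSub {n : ℕ} (k l : Fin n) (m : ℤ) :
    MvPolynomial (Fin n) ℤ →ₐ[ℤ] MvPolynomial (Fin n) ℤ :=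
  aeval fun i => if i = k then X k + C m * X l else X i

theorem bottSub_X {n : ℕ} (k l : Fin n) (m : ℤ) (i : Fin n) :
    bottSub k l m (X i) = if i = k then X k + C m * X l else X i := by
  simp [bottSub]

theorem bottSub_comp {n : ℕ} (k l : Fin n) (hkl : l ≠ k) (m m' : ℤ) (h : m' + m = 0) :
    (bottSub k l m).comp (bottSub k l m') = AlgHom.id ℤ _ := by
  apply MvPolynomial.algHom_ext
  intro i
  have hC : (C m' + C m : MvPolynomial (Fin n) ℤ) = 0 := by rw [← C_add, h, C_0]
  have hc : bottSub k l m (C m') = C m' := (bottSub k l m).commutes m'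
  rw [AlgHom.comp_apply, bottSub_X]
  split_ifs with hi
  · subst hi
    rw [map_add, map_mul, bottSub_X, bottSub_X, if_pos rfl, if_neg hkl, hc]
    simp only [AlgHom.id_apply]
    linear_combination X l * hC
  · rw [bottSub_X, if_neg hi]; rfl

noncomputable def bottSubEquiv {n : ℕ} (k l : Fin n) (hkl : l ≠ k) (m : ℤ) :
    MvPolynomial (Fin n) ℤ ≃ₐ[ℤ] MvPolynomial (Fin n) ℤ :=
  AlgEquiv.ofAlgHom (bottSub k l m) (bottSub k l (-m))
    (bottSub_comp k l hkl _ _ (by ring)) (bottSub_comp k l hkl _ _ (by ring))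

theorem bottSub_sum {n : ℕ} (k l : Fin n) (m : ℤ) (B : Fin n → ℤ) :
    bottSub k l m (∑ j, C (B j) * X j) = ∑ j, C (B j) * X j + C (m * B k) * X l := by
  have hc : ∀ c, bottSub k l m (C c) = C c := (bottSub k l m).commutes
  have : ∀ j, bottSub k l m (C (B j) * X j)
      = C (B j) * X j + (if j = k then C (m * B k) * X l else 0) := by
    intro j
    rw [map_mul, hc, bottSub_X]
    split_ifs with hj
    · subst hj
      rw [C_mul]; ring
    · rw [add_zero]
  rw [map_sum]
  simp only [this, Finset.sum_add_distrib, Finset.sum_ite_eq', Finset.sum_ite_eq, Finset.mem_univ, if_true]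

/-- If `x_k` is of even exceptional type (`A^k_ℓ = −2m`, `A^k_j = −m·A^ℓ_j` for `j ≠ ℓ`),
then the substitution `x_k ↦ x_k + m·x_ℓ`, `x_i ↦ x_i (i ≠ k)` descends to a ring
isomorphism `H^*(M_A;ℤ) ≅ H^*(M_Ã;ℤ)`, where `Ã` agrees with `A` away from column `ℓ`,
`Ã^k_ℓ = 0`, and `Ã^i_ℓ = A^i_ℓ + m·A^i_k` for `i ≠ k`. -/
theorem stmt_13 (n : ℕ) (hn : 2 ≤ n) (A : Matrix (Fin n) (Fin n) ℤ)
    (hA : ∀ i j : Fin n, ¬i < j → A i j = 0)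
    (k l : Fin n) (hkl : k < l) (m : ℤ)
    (h1 : A k l = -(2 * m)) (h2 : ∀ j : Fin n, j ≠ l → A k j = -(m * A l j))
    (A' : Matrix (Fin n) (Fin n) ℤ)
    (hA'1 : ∀ i j : Fin n, j ≠ l → A' i j = A i j)
    (hA'2 : A' k l = 0)
    (hA'3 : ∀ i : Fin n, i ≠ k → A' i l = A i l + m * A i k) :
    ∃ e : (MvPolynomial (Fin n) ℤ ⧸ bottIdeal A) ≃+* (MvPolynomial (Fin n) ℤ ⧸ bottIdeal A'),
      ∀ i : Fin n, e (Ideal.Quotient.mk (bottIdeal A) (X i)) =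
        Ideal.Quotient.mk (bottIdeal A') (if i = k then X k + C m * X l else X i) := by
  have hlk : l ≠ k := hkl.ne'
  have hc : ∀ c, bottSub k l m (C c) = C c := (bottSub k l m).commutes
  have hg : ∀ (B : Matrix (Fin n) (Fin n) ℤ) (i : Fin n),
      (X i ^ 2 + ∑ j, C (B i j) * X j * X i : MvPolynomial (Fin n) ℤ)
        = X i ^ 2 + (∑ j, C (B i j) * X j) * X i := by
    intro B i; rw [Finset.sum_mul]
  -- the generators
  have hI : ∀ B : Matrix (Fin n) (Fin n) ℤ, bottIdeal B = Ideal.span (Set.range fun i : Fin n =>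
      (X i ^ 2 + (∑ j, C (B i j) * X j) * X i : MvPolynomial (Fin n) ℤ)) := by
    intro B; unfold bottIdeal; simp only [hg]
  have hgi : ∀ i, i ≠ k → bottSub k l m (X i ^ 2 + (∑ j, C (A i j) * X j) * X i)
      = X i ^ 2 + (∑ j, C (A' i j) * X j) * X i := by
    intro i hi
    rw [map_add, map_pow, map_mul, bottSub_sum, bottSub_X, if_neg hi,
      bott_sum_update (A i) (A' i) l _ (hA'1 i) (hA'3 i hi)]
  have hll : A l l = 0 := hA l l (lt_irrefl _)
  have hlk0 : A l k = 0 := hA l k (not_lt.mpr hkl.le)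
  have hkk : A k k = 0 := hA k k (lt_irrefl _)
  have eA'l : (∑ j, C (A' l j) * X j : MvPolynomial (Fin n) ℤ) = ∑ j, C (A l j) * X j := by
    rw [bott_sum_update (A l) (A' l) l _ (hA'1 l) (hA'3 l hlk), hlk0]; simp
  have eA'k : (∑ j, C (A' k j) * X j : MvPolynomial (Fin n) ℤ)
      = - C m * ∑ j, C (A l j) * X j := by
    rw [Finset.mul_sum]
    refine Finset.sum_congr rfl fun j _ => ?_
    by_cases hj : j = l
    · subst hj; rw [hA'2, hll]; simp
    · rw [hA'1 k j hj, h2 j hj, C_neg, C_mul]; ring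
  have eAk : (∑ j, C (A k j) * X j : MvPolynomial (Fin n) ℤ)
      = ∑ j, C (A' k j) * X j - 2 * C m * X l := by
    rw [bott_sum_update (A k) (A' k) l (2 * m) (hA'1 k) (by rw [hA'2, h1]; ring), C_mul]
    simp
  have hgk : bottSub k l m (X k ^ 2 + (∑ j, C (A k j) * X j) * X k)
      = (X k ^ 2 + (∑ j, C (A' k j) * X j) * X k)
        - C m ^ 2 * (X l ^ 2 + (∑ j, C (A' l j) * X j) * X l) := by
    rw [map_add, map_pow, map_mul, bottSub_sum, bottSub_X, if_pos rfl, hkk, eAk, eA'k, eA'l]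
    simp only [mul_zero, C_0]
    ring
  have hmap : bottIdeal A' = (bottIdeal A).map
      ((bottSubEquiv k l hlk m : MvPolynomial (Fin n) ℤ ≃+* MvPolynomial (Fin n) ℤ) :
        MvPolynomial (Fin n) ℤ →+* MvPolynomial (Fin n) ℤ) := by
    have hf : ∀ p, ((bottSubEquiv k l hlk m : MvPolynomial (Fin n) ℤ ≃+* MvPolynomial (Fin n) ℤ) :
        MvPolynomial (Fin n) ℤ →+* MvPolynomial (Fin n) ℤ) p = bottSub k l m p := fun _ => rfl
    apply le_antisymm
    · have hmem : ∀ i, bottSub k l m (X i ^ 2 + (∑ j, C (A i j) * X j) * X i) ∈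
          (bottIdeal A).map ((bottSubEquiv k l hlk m :
            MvPolynomial (Fin n) ℤ ≃+* MvPolynomial (Fin n) ℤ) :
            MvPolynomial (Fin n) ℤ →+* MvPolynomial (Fin n) ℤ) := by
        intro i
        rw [← hf]
        apply Ideal.mem_map_of_mem
        rw [hI]
        exact Ideal.subset_span ⟨i, rfl⟩
      rw [hI A', Ideal.span_le]
      rintro _ ⟨i, rfl⟩
      by_cases hi : i = k
      · subst hi
        have a := hmem i
        have b := hmem l
        rw [hgk] at a
        rw [hgi l hlk] at b
        have := Ideal.add_mem _ a (Ideal.mul_mem_left _ (C m ^ 2) b)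
        rwa [sub_add_cancel] at this
      · have a := hmem i
        rw [hgi i hi] at a
        exact a
    · have hmem : ∀ i, (X i ^ 2 + (∑ j, C (A' i j) * X j) * X i : MvPolynomial (Fin n) ℤ) ∈
          bottIdeal A' := by
        intro i
        rw [hI]
        exact Ideal.subset_span ⟨i, rfl⟩
      rw [hI A, Ideal.map_span, Ideal.span_le]
      rintro _ ⟨_, ⟨i, rfl⟩, rfl⟩
      change bottSub k l m (X i ^ 2 + (∑ j, C (A i j) * X j) * X i) ∈ bottIdeal A'
      by_cases hi : i = k
      · subst hi
        rw [hgk]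
        exact Ideal.sub_mem _ (hmem i) (Ideal.mul_mem_left _ _ (hmem l))
      · rw [hgi i hi]
        exact hmem i
  refine ⟨Ideal.quotientEquiv (bottIdeal A) (bottIdeal A')
    (bottSubEquiv k l hlk m : MvPolynomial (Fin n) ℤ ≃+* MvPolynomial (Fin n) ℤ) hmap, ?_⟩
  intro i
  rw [← bottSub_X]
  rfl
end
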